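/- Let m be a natural number, let A be a finite non-empty subset of S_{4,m}, let τ ≥ 1 be a real number, and let P_τ = { n ∈ ℝ⁴ : τ ≤ r_2(A, n) < 2τ }. For every ε > 0 there is a constant C(ε) > 0, independent of m, A and τ, such that |P_τ| · τ ≤ C(ε) · m^ε · ( |P_τ|^{6/7} · |A|^{4/7} + |P_τ| + |A| ). -/

import Mathlib

open Finset

noncomputable section

/-- The set of lattice points on the sphere of radius `√m` in `ℤ^d`. -/
def latSphere (d m : ℕ) : Set (Fin d → ℤ) := {x | ∑ i, x i ^ 2 = (m : ℤ)}

/-- The additive energy `E_{s,2}(A)`: the number of `2s`-tuples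
`(x₁, …, x_{2s}) ∈ A^{2s}` with `x₁ + ⋯ + x_s = x_{s+1} + ⋯ + x_{2s}`. -/
def addEnergy {V : Type*} [AddCommMonoid V] (s : ℕ) (A : Set V) : ℕ :=
  Nat.card {p : (Fin s → V) × (Fin s → V) //
    (∀ i, p.1 i ∈ A) ∧ (∀ i, p.2 i ∈ A) ∧ ∑ i, p.1 i = ∑ i, p.2 i}

/-- The representation function `r_s(A, n)`: the number of `s`-tuples
`(x₁, …, x_s) ∈ A^s` with `x₁ + ⋯ + x_s = n`. -/
def repCount {V : Type*} [AddCommMonoid V] (s : ℕ) (A : Set V) (n : V) : ℕ :=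
  Nat.card {x : Fin s → V // (∀ i, x i ∈ A) ∧ ∑ i, x i = n}


lemma divisor_bound (ε : ℝ) (hε : 0 < ε) :
    ∃ C : ℝ, 1 ≤ C ∧ ∀ n : ℕ, 0 < n → (n.divisors.card : ℝ) ≤ C * (n : ℝ) ^ ε := by
  -- `K` bounds the small primes
  obtain ⟨K, hK⟩ := exists_nat_gt ((2 : ℝ) ^ (1 / ε))
  -- constant for the small primes
  have h2 : (1 : ℝ) < 2 ^ ε := Real.one_lt_rpow (by norm_num) hε
  set q : ℝ := 2 ^ ε with hq
  set C0 : ℝ := 1 + 1 / (q - 1) with hC0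
  have hq1 : 0 < q - 1 := by linarith
  have hC01 : 1 ≤ C0 := by rw [hC0]; have : 0 < 1 / (q - 1) := by positivity
                           linarith
  have hsmall : ∀ e : ℕ, (e : ℝ) + 1 ≤ C0 * q ^ e := by
    intro e
    have h := one_add_mul_le_pow (show (-2 : ℝ) ≤ q - 1 by linarith) e
    have hqe : 1 ≤ q ^ e := one_le_pow₀ h2.le
    have h3 : (e : ℝ) * (q - 1) ≤ q ^ e := by
      have : 1 + (q - 1) = q := by ring
      rw [this] at h; linarith
    have h4 : (e : ℝ) ≤ 1 / (q - 1) * q ^ e := by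
      rw [div_mul_eq_mul_div, one_mul, le_div_iff₀ hq1]; exact h3
    rw [hC0]; nlinarith
  refine ⟨C0 ^ K, one_le_pow₀ hC01, fun n hn => ?_⟩
  have hn0 : n ≠ 0 := hn.ne'
  rw [Nat.card_divisors hn0]
  have hprod : (n : ℝ) ^ ε = ∏ p ∈ n.primeFactors, ((p : ℝ) ^ ε) ^ (n.factorization p) := by
    conv_lhs => rw [← Nat.prod_factorization_pow_eq_self hn0]
    rw [Finsupp.prod, Nat.support_factorization]
    push_cast
    rw [← Real.finsetProd_rpow]
    · refine Finset.prod_congr rfl fun p _ => ?_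
      rw [← Real.rpow_natCast, ← Real.rpow_natCast, ← Real.rpow_mul (by positivity),
        ← Real.rpow_mul (by positivity), mul_comm]
    · intro i _; positivity
  rw [hprod]
  push_cast
  have hfac : ∀ p ∈ n.primeFactors, ((n.factorization p : ℝ) + 1) ≤
      (if p < K then C0 else 1) * ((p : ℝ) ^ ε) ^ (n.factorization p) := by
    intro p hp
    have hp2 : 2 ≤ p := (Nat.prime_of_mem_primeFactors hp).two_le
    have hp2' : (2 : ℝ) ≤ p := by exact_mod_cast hp2
    split_ifs with h
    · refine (hsmall _).trans ?_
      have hqp : q ≤ (p : ℝ) ^ ε := by rw [hq]; gcongr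
      gcongr
    · have hKp : (2 : ℝ) ^ (1 / ε) ≤ p := hK.le.trans (by exact_mod_cast not_lt.1 h)
      have : (2 : ℝ) ≤ (p : ℝ) ^ ε := by
        calc (2 : ℝ) = ((2 : ℝ) ^ (1 / ε)) ^ ε := by
              rw [← Real.rpow_mul (by norm_num)]; field_simp; simp
          _ ≤ _ := by gcongr
      rw [one_mul]
      calc ((n.factorization p : ℝ) + 1) ≤ (2 : ℝ) ^ (n.factorization p) := by
            exact_mod_cast Nat.lt_two_pow_self
        _ ≤ _ := by gcongr
  refine (Finset.prod_le_prod (fun p _ => by positivity) hfac).trans ?_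
  rw [Finset.prod_mul_distrib]
  refine mul_le_mul_of_nonneg_right ?_ (Finset.prod_nonneg fun p _ => by positivity)
  rw [← Finset.prod_filter, Finset.prod_const]
  refine pow_le_pow_right₀ hC01 ?_
  calc _ ≤ (Finset.range K).card := Finset.card_le_card fun p hp => by
        simp at hp ⊢; exact hp.2
    _ = K := by simp

/-- Fibre bound: solutions of `X² + D Y² = N` with `N ∣ 2 W`. -/
lemma fibre_bound (D N : ℕ) (hD : 0 < D) (hN : 0 < N) (T : Finset (ℤ × ℤ))
    (hT : ∀ t ∈ T, t.1 ^ 2 + D * t.2 ^ 2 = (N : ℤ))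
    (h : ∀ t ∈ T, ∀ t' ∈ T, (N : ℤ) ∣ 2 * (t.1 * t'.2 - t'.1 * t.2)) : T.card ≤ 10 := by
  rcases T.eq_empty_or_nonempty with rfl | ⟨⟨a, b⟩, hab⟩
  · simp
  have hN' : (0 : ℤ) < N := by exact_mod_cast hN
  have hD' : (1 : ℤ) ≤ D := by exact_mod_cast hD
  have h1 := hT _ hab
  simp only at h1
  have hcard : ((Finset.Icc (-2 : ℤ) 2) ×ˢ (Finset.univ : Finset Bool)).card = 10 := by decide
  rw [← hcard]
  refine Finset.card_le_card_of_injOn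
    (fun t => (2 * (a * t.2 - t.1 * b) / N, decide (0 ≤ a * t.1 + D * (b * t.2)))) ?_ ?_
  · rintro ⟨x, y⟩ ht
    have h2 := hT _ ht
    obtain ⟨k, hk⟩ := h _ hab _ ht
    simp only at h2 hk
    simp only [Finset.coe_product, Set.mem_prod, Finset.coe_Icc, Set.mem_Icc, Finset.coe_univ,
      Set.mem_univ, and_true]
    rw [hk, Int.mul_ediv_cancel_left _ hN'.ne']
    have h3 : (a * x + D * (b * y)) ^ 2 + D * (a * y - x * b) ^ 2 = (N : ℤ) ^ 2 := by
      have : (N : ℤ) ^ 2 = (a ^ 2 + D * b ^ 2) * (x ^ 2 + D * y ^ 2) := by rw [h1, h2]; ring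
      rw [this]; ring
    have h4 : D * k ^ 2 * (N : ℤ) ^ 2 ≤ 4 * (N : ℤ) ^ 2 := by
      have : D * k ^ 2 * (N : ℤ) ^ 2 = 4 * (D * (a * y - x * b) ^ 2) := by
        have : ((N : ℤ) * k) ^ 2 = (2 * (a * y - x * b)) ^ 2 := by rw [hk]
        linear_combination (D : ℤ) * this
      rw [this]; nlinarith [sq_nonneg (a * x + D * (b * y))]
    have h5 : D * k ^ 2 ≤ 4 := le_of_mul_le_mul_right h4 (by positivity)
    have h6 : k ^ 2 ≤ 4 := by nlinarith [sq_nonneg k]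
    constructor <;> nlinarith
  · rintro ⟨x, y⟩ ht ⟨x', y'⟩ ht' heq
    have h2 := hT _ ht
    have h2' := hT _ ht'
    obtain ⟨k, hk⟩ := h _ hab _ ht
    obtain ⟨k', hk'⟩ := h _ hab _ ht'
    simp only at h2 h2' hk hk'
    simp only [Prod.mk.injEq] at heq
    obtain ⟨e1, e2⟩ := heq
    rw [hk, hk', Int.mul_ediv_cancel_left _ hN'.ne', Int.mul_ediv_cancel_left _ hN'.ne'] at e1
    subst e1
    have hW : a * y - x * b = a * y' - x' * b := by linarith
    have h3 : (a * x + D * (b * y)) ^ 2 + D * (a * y - x * b) ^ 2 = (N : ℤ) ^ 2 := by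
      have : (N : ℤ) ^ 2 = (a ^ 2 + D * b ^ 2) * (x ^ 2 + D * y ^ 2) := by rw [h1, h2]; ring
      rw [this]; ring
    have h3' : (a * x' + D * (b * y')) ^ 2 + D * (a * y' - x' * b) ^ 2 = (N : ℤ) ^ 2 := by
      have : (N : ℤ) ^ 2 = (a ^ 2 + D * b ^ 2) * (x' ^ 2 + D * y' ^ 2) := by rw [h1, h2']; ring
      rw [this]; ring
    rw [hW] at h3
    have hsq : (a * x + D * (b * y)) ^ 2 = (a * x' + D * (b * y')) ^ 2 := by linarith
    have hV : a * x + D * (b * y) = a * x' + D * (b * y') := by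
      rcases sq_eq_sq_iff_eq_or_eq_neg.1 hsq with h | h
      · exact h
      · by_cases h0 : 0 ≤ a * x + D * (b * y)
        · have h0' : 0 ≤ a * x' + D * (b * y') := by simpa [h0] using e2
          linarith
        · have h0' : ¬ 0 ≤ a * x' + D * (b * y') := by simpa [h0] using e2
          linarith
    have ex : (N : ℤ) * x = N * x' := by
      rw [← h1]; linear_combination a * hV - D * b * hW
    have ey : (N : ℤ) * y = N * y' := by
      rw [← h1]; linear_combination a * hW + b * hV
    rw [mul_right_injective₀ hN'.ne' ex, mul_right_injective₀ hN'.ne' ey]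

lemma prim_base (D N : ℕ) (hD : 0 < D) (hN : 0 < N)
    (hred : ∀ p : ℕ, p.Prime → p ^ 2 ∣ D → ¬ p ∣ N) (T : Finset (ℤ × ℤ))
    (hT : ∀ t ∈ T, t.1 ^ 2 + D * t.2 ^ 2 = (N : ℤ) ∧ IsCoprime t.1 t.2) :
    T.card ≤ 10 * N.divisors.card := by
  rcases T.eq_empty_or_nonempty with rfl | ⟨⟨a, b⟩, hab⟩
  · simp
  have hN' : (0 : ℤ) < N := by exact_mod_cast hN
  have hco : ∀ t ∈ T, IsCoprime t.2 (N : ℤ) := by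
    intro t ht
    obtain ⟨h1, h2⟩ := hT t ht
    rw [← h1]
    have : IsCoprime t.2 (t.1 ^ 2) := h2.symm.pow_right
    have h3 := this.add_mul_left_right (D * t.2)
    have h4 : t.1 ^ 2 + t.2 * (D * t.2) = t.1 ^ 2 + D * t.2 ^ 2 := by ring
    rwa [h4] at h3
  obtain ⟨h1, h1c⟩ := hT _ hab
  have hb := hco _ hab
  simp only at h1 h1c hb
  refine Finset.card_le_mul_card_image_of_maps_to
    (f := fun t : ℤ × ℤ => Int.gcd N (a * t.2 - t.1 * b)) (t := N.divisors) ?_ 10 ?_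
  · intro t _
    rw [Nat.mem_divisors]
    refine ⟨?_, hN.ne'⟩
    have := Int.gcd_dvd_left (N : ℤ) (a * t.2 - t.1 * b)
    exact_mod_cast this
  intro g hg
  have hgN : g ∣ N := (Nat.mem_divisors.1 hg).1
  obtain ⟨g', hgg'⟩ := hgN
  have hg0 : g ≠ 0 := by rintro rfl; simp at hgg'; omega
  have hgz : (N : ℤ) = g * g' := by exact_mod_cast hgg'
  have key : ∀ t ∈ T, Int.gcd N (a * t.2 - t.1 * b) = g →
      (g : ℤ) ∣ a * t.2 - t.1 * b ∧ (g' : ℤ) ∣ a * t.2 + t.1 * b := by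
    rintro ⟨x, y⟩ ht hgt
    obtain ⟨h2, -⟩ := hT _ ht
    simp only at h2 hgt ⊢
    have hd : (g : ℤ) ∣ a * y - x * b := by rw [← hgt]; exact Int.gcd_dvd_right _ _
    refine ⟨hd, ?_⟩
    obtain ⟨u, hu⟩ := hd
    have hcop : IsCoprime (g' : ℤ) u := by
      rw [Int.isCoprime_iff_gcd_eq_one]
      rw [hu, hgz, Int.gcd_mul_left] at hgt
      simp only [Int.natAbs_natCast] at hgt
      exact Nat.eq_of_mul_eq_mul_left (Nat.pos_of_ne_zero hg0) (by rw [hgt, mul_one])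
    have hdvd : (N : ℤ) ∣ (a * y - x * b) * (a * y + x * b) := by
      refine ⟨y ^ 2 - b ^ 2, ?_⟩
      linear_combination y ^ 2 * h1 - b ^ 2 * h2
    rw [hgz, hu, mul_assoc] at hdvd
    have := Int.dvd_of_mul_dvd_mul_left (by exact_mod_cast hg0) hdvd
    exact hcop.dvd_of_dvd_mul_left this
  refine fibre_bound D N hD hN _ (fun t ht => (hT t (Finset.mem_filter.1 ht).1).1) ?_
  rintro ⟨x, y⟩ ht ⟨x', y'⟩ ht'
  rw [Finset.mem_filter] at ht ht'
  obtain ⟨k1, k2⟩ := key _ ht.1 ht.2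
  obtain ⟨k1', k2'⟩ := key _ ht'.1 ht'.2
  have hy := hco _ ht.1
  simp only at k1 k2 k1' k2' hy ⊢
  have hgb : IsCoprime (g : ℤ) b := (hb.of_isCoprime_of_dvd_right ⟨g', hgz⟩).symm
  have hgb' : IsCoprime (g' : ℤ) b :=
    (hb.of_isCoprime_of_dvd_right ⟨g, by rw [hgz]; ring⟩).symm
  have w1 : (g : ℤ) ∣ x * y' - x' * y := by
    refine hgb.dvd_of_dvd_mul_left ?_
    have := (k1'.mul_left y).sub (k1.mul_left y')
    convert this using 1; ring
  have w2 : (g' : ℤ) ∣ x * y' - x' * y := by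
    refine hgb'.dvd_of_dvd_mul_left ?_
    have := (k2.mul_left y').sub (k2'.mul_left y)
    convert this using 1; ring
  -- the gcd divides 2
  set h : ℕ := Nat.gcd g g' with hh
  have hhg : (h : ℤ) ∣ g := by exact_mod_cast Nat.gcd_dvd_left g g'
  have hhg' : (h : ℤ) ∣ g' := by exact_mod_cast Nat.gcd_dvd_right g g'
  have hh2 : (h : ℤ) ∣ 2 := by
    have e1 : (h : ℤ) ∣ 2 * a * y := by
      have h3 := (hhg.trans k1).add (hhg'.trans k2)
      have h4 : a * y - x * b + (a * y + x * b) = 2 * a * y := by ring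
      rwa [h4] at h3
    have c1 : IsCoprime (h : ℤ) y :=
      (hy.of_isCoprime_of_dvd_right (hhg.trans ⟨g', hgz⟩)).symm
    have e2 : (h : ℤ) ∣ 2 * a := c1.dvd_of_dvd_mul_right e1
    have c2 : IsCoprime (h : ℤ) a := by
      rw [Int.isCoprime_iff_gcd_eq_one]
      by_contra hne
      obtain ⟨p, hp, hpd⟩ := Nat.exists_prime_and_dvd hne
      have hph : (p : ℤ) ∣ h := (Int.natCast_dvd_natCast.2 hpd).trans (Int.gcd_dvd_left _ _)
      have hpa : (p : ℤ) ∣ a := (Int.natCast_dvd_natCast.2 hpd).trans (Int.gcd_dvd_right _ _)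
      have hpN : (p : ℤ) ^ 2 ∣ N := by
        rw [hgz, sq]; exact mul_dvd_mul (hph.trans hhg) (hph.trans hhg')
      have hpN1 : (p : ℤ) ∣ N := (Dvd.intro_left _ (by rw [sq])).trans hpN
      have hpb : IsCoprime ((p : ℤ) ^ 2) (b ^ 2) :=
        ((hb.of_isCoprime_of_dvd_right hpN1).symm).pow
      have hpD : (p : ℤ) ^ 2 ∣ D := by
        refine hpb.dvd_of_dvd_mul_right ?_
        have := hpN.sub (pow_dvd_pow_of_dvd hpa 2)
        convert this using 1; rw [← h1]; ring
      exact hred p hp (by exact_mod_cast hpD) (by exact_mod_cast hpN1)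
    exact c2.dvd_of_dvd_mul_right e2
  have hl : (Nat.lcm g g' : ℤ) ∣ x * y' - x' * y := by
    have := Int.coe_lcm_dvd w1 w2
    simpa [Int.lcm] using this
  have hgl : (N : ℤ) = h * Nat.lcm g g' := by
    rw [hgz]; exact_mod_cast (Nat.gcd_mul_lcm g g').symm
  rw [hgl]
  exact mul_dvd_mul hh2 hl

lemma prim_count (N : ℕ) : ∀ (D : ℕ), 0 < D → 0 < N → ∀ (T : Finset (ℤ × ℤ)),
    (∀ t ∈ T, t.1 ^ 2 + D * t.2 ^ 2 = (N : ℤ) ∧ IsCoprime t.1 t.2) →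
    T.card ≤ 10 * N.divisors.card := by
  induction N using Nat.strong_induction_on with
  | _ N ih =>
  intro D hD hN T hT
  by_cases hred : ∀ p : ℕ, p.Prime → p ^ 2 ∣ D → ¬ p ∣ N
  · exact prim_base D N hD hN hred T hT
  push Not at hred
  obtain ⟨p, hp, ⟨D', rfl⟩, hpN⟩ := hred
  rcases T.eq_empty_or_nonempty with rfl | ⟨t0, ht0⟩
  · simp
  have hpz : Prime (p : ℤ) := Nat.prime_iff_prime_int.1 hp
  have hpX : ∀ t ∈ T, (p : ℤ) ∣ t.1 := by
    intro t ht
    obtain ⟨h1, -⟩ := hT t ht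
    refine hpz.dvd_of_dvd_pow (n := 2) ?_
    have hpN' : (p : ℤ) ∣ N := by exact_mod_cast hpN
    have := hpN'.sub (Dvd.intro (p * D' * t.2 ^ 2 : ℤ) rfl)
    convert this using 1; rw [← h1]; push_cast; ring
  have hp2 : p ^ 2 ∣ N := by
    obtain ⟨c, hc⟩ := hpX t0 ht0
    have h1 := (hT t0 ht0).1
    rw [hc] at h1
    have : ((p ^ 2 : ℕ) : ℤ) ∣ N := ⟨c ^ 2 + D' * t0.2 ^ 2, by rw [← h1]; push_cast; ring⟩
    exact_mod_cast this
  obtain ⟨N', rfl⟩ := hp2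
  have hN'0 : 0 < N' := Nat.pos_of_mul_pos_left hN
  have hD'0 : 0 < D' := Nat.pos_of_mul_pos_left hD
  have hlt : N' < p ^ 2 * N' := by
    have h2 := hp.two_le
    have h4 : 2 ≤ p ^ 2 := by nlinarith
    nlinarith
  have hp0 : (p : ℤ) ≠ 0 := hpz.ne_zero
  have hih := ih N' hlt D' hD'0 hN'0 (T.image fun t => (t.1 / p, t.2)) ?_
  · rw [Finset.card_image_of_injOn] at hih
    · refine hih.trans (Nat.mul_le_mul_left _ (Finset.card_le_card ?_))
      exact Nat.divisors_subset_of_dvd hN.ne' (Dvd.intro_left _ rfl)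
    · intro t ht t' ht' he
      simp only [Prod.mk.injEq] at he
      obtain ⟨c, hc⟩ := hpX t ht
      obtain ⟨c', hc'⟩ := hpX t' ht'
      rw [hc, hc', Int.mul_ediv_cancel_left _ hp0, Int.mul_ediv_cancel_left _ hp0] at he
      exact Prod.ext (by rw [hc, hc', he.1]) he.2
  · intro s hs
    obtain ⟨t, ht, rfl⟩ := Finset.mem_image.1 hs
    obtain ⟨c, hc⟩ := hpX t ht
    obtain ⟨h1, h2⟩ := hT t ht
    simp only
    rw [hc, Int.mul_ediv_cancel_left _ hp0]
    rw [hc] at h1 h2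
    refine ⟨?_, h2.of_mul_left_right⟩
    push_cast at h1
    have : (p : ℤ) ^ 2 * (c ^ 2 + D' * t.2 ^ 2) = p ^ 2 * N' := by rw [← h1]; ring
    exact mul_left_cancel₀ (pow_ne_zero 2 hp0) this

lemma form_count (D N : ℕ) (hD : 0 < D) (hN : 0 < N) (T : Finset (ℤ × ℤ))
    (hT : ∀ t ∈ T, t.1 ^ 2 + D * t.2 ^ 2 = (N : ℤ)) :
    T.card ≤ 10 * N.divisors.card ^ 2 := by
  have hN' : (0 : ℤ) < N := by exact_mod_cast hN
  have hdv : ∀ t ∈ T, (Int.gcd t.1 t.2) ^ 2 ∣ N := by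
    intro t ht
    have h1 := hT t ht
    have a1 : (Int.gcd t.1 t.2 : ℤ) ^ 2 ∣ t.1 ^ 2 := pow_dvd_pow_of_dvd (Int.gcd_dvd_left _ _) 2
    have a2 : (Int.gcd t.1 t.2 : ℤ) ^ 2 ∣ t.2 ^ 2 := pow_dvd_pow_of_dvd (Int.gcd_dvd_right _ _) 2
    have : (Int.gcd t.1 t.2 : ℤ) ^ 2 ∣ N := by rw [← h1]; exact a1.add (a2.mul_left _)
    exact_mod_cast this
  rw [sq, ← mul_assoc]
  refine Finset.card_le_mul_card_image_of_maps_to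
    (f := fun t : ℤ × ℤ => Int.gcd t.1 t.2) (t := N.divisors) ?_ _ ?_
  · intro t ht
    rw [Nat.mem_divisors]
    exact ⟨(Dvd.intro_left _ (by rw [sq])).trans (hdv t ht), hN.ne'⟩
  intro e he
  by_cases hne : (T.filter fun t => Int.gcd t.1 t.2 = e) = ∅
  · rw [hne]; simp
  obtain ⟨t0, ht0⟩ := Finset.nonempty_iff_ne_empty.2 hne
  rw [Finset.mem_filter] at ht0
  obtain ⟨N', hNN'⟩ := hdv t0 ht0.1
  rw [ht0.2] at hNN'
  have he0 : e ≠ 0 := by rintro rfl; simp at hNN'; omega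
  have hez : (e : ℤ) ≠ 0 := by exact_mod_cast he0
  have hN'0 : 0 < N' := Nat.pos_of_ne_zero (by rintro rfl; simp at hNN'; omega)
  have hih := prim_count N' D hD hN'0
    ((T.filter fun t => Int.gcd t.1 t.2 = e).image fun t => (t.1 / e, t.2 / e)) ?_
  · rw [Finset.card_image_of_injOn] at hih
    · refine hih.trans (Nat.mul_le_mul_left _ (Finset.card_le_card ?_))
      exact Nat.divisors_subset_of_dvd hN.ne' ⟨e ^ 2, by rw [hNN']; ring⟩
    · intro t ht t' ht' hee
      have ht := (Finset.mem_filter.1 ht).2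
      have ht' := (Finset.mem_filter.1 ht').2
      simp only [Prod.mk.injEq] at hee
      have d1 : (e : ℤ) ∣ t.1 := by rw [← ht]; exact Int.gcd_dvd_left _ _
      have d2 : (e : ℤ) ∣ t.2 := by rw [← ht]; exact Int.gcd_dvd_right _ _
      have d1' : (e : ℤ) ∣ t'.1 := by rw [← ht']; exact Int.gcd_dvd_left _ _
      have d2' : (e : ℤ) ∣ t'.2 := by rw [← ht']; exact Int.gcd_dvd_right _ _
      refine Prod.ext ?_ ?_
      · rw [← Int.ediv_mul_cancel d1, hee.1, Int.ediv_mul_cancel d1']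
      · rw [← Int.ediv_mul_cancel d2, hee.2, Int.ediv_mul_cancel d2']
  · intro s hs
    obtain ⟨t, ht, rfl⟩ := Finset.mem_image.1 hs
    rw [Finset.mem_filter] at ht
    have d1 : (e : ℤ) ∣ t.1 := by rw [← ht.2]; exact Int.gcd_dvd_left _ _
    have d2 : (e : ℤ) ∣ t.2 := by rw [← ht.2]; exact Int.gcd_dvd_right _ _
    obtain ⟨c1, hc1⟩ := d1
    obtain ⟨c2, hc2⟩ := d2
    have h1 := hT t ht.1
    have h2 := ht.2
    simp only
    rw [hc1, hc2] at h1 h2 ⊢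
    rw [Int.mul_ediv_cancel_left _ hez, Int.mul_ediv_cancel_left _ hez]
    constructor
    · have : (e : ℤ) ^ 2 * (c1 ^ 2 + D * c2 ^ 2) = e ^ 2 * N' := by
        have h3 : (N : ℤ) = e ^ 2 * N' := by exact_mod_cast hNN'
        rw [← h3, ← h1]; ring
      exact mul_left_cancel₀ (pow_ne_zero 2 hez) this
    · rw [Int.isCoprime_iff_gcd_eq_one]
      rw [Int.gcd_mul_left] at h2
      simp only [Int.natAbs_natCast] at h2
      exact Nat.eq_of_mul_eq_mul_left (Nat.pos_of_ne_zero he0) (by rw [h2, mul_one])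
/-- The determinant of four integer vectors. -/
def det4 (n p e x : Fin 4 → ℤ) : ℤ :=
  (n 0 * (p 1 * (e 2 * x 3 - e 3 * x 2) - p 2 * (e 1 * x 3 - e 3 * x 1) + p 3 * (e 1 * x 2 - e 2 * x 1))
     - n 1 * (p 0 * (e 2 * x 3 - e 3 * x 2) - p 2 * (e 0 * x 3 - e 3 * x 0) + p 3 * (e 0 * x 2 - e 2 * x 0))
     + n 2 * (p 0 * (e 1 * x 3 - e 3 * x 1) - p 1 * (e 0 * x 3 - e 3 * x 0) + p 3 * (e 0 * x 1 - e 1 * x 0))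
     - n 3 * (p 0 * (e 1 * x 2 - e 2 * x 1) - p 1 * (e 0 * x 2 - e 2 * x 0) + p 2 * (e 0 * x 1 - e 1 * x 0)))

lemma gram4 (n p e x : Fin 4 → ℤ) :
    (∑ i, e i * n i = 0) → (∑ i, e i * p i = 0) →
    (det4 n p e x) ^ 2
    + ((∑ i, n i ^ 2) * (∑ i, p i ^ 2) - (∑ i, n i * p i) ^ 2) * (∑ i, e i * x i) ^ 2
    = (∑ i, e i ^ 2) * ((∑ i, x i ^ 2) * ((∑ i, n i ^ 2) * (∑ i, p i ^ 2) - (∑ i, n i * p i) ^ 2)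
      - ((∑ i, n i * x i) ^ 2 * (∑ i, p i ^ 2)
        - 2 * (∑ i, n i * p i) * (∑ i, n i * x i) * (∑ i, p i * x i)
        + (∑ i, p i * x i) ^ 2 * (∑ i, n i ^ 2))) := by
  have gram : 
    (det4 n p e x) ^ 2
     = Matrix.det !![∑ i, n i ^ 2, ∑ i, n i * p i, ∑ i, e i * n i, ∑ i, n i * x i;
         ∑ i, n i * p i, ∑ i, p i ^ 2, ∑ i, e i * p i, ∑ i, p i * x i;
         ∑ i, e i * n i, ∑ i, e i * p i, ∑ i, e i ^ 2, ∑ i, e i * x i;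
         ∑ i, n i * x i, ∑ i, p i * x i, ∑ i, e i * x i, ∑ i, x i ^ 2] := by
    have hM : !![∑ i, n i ^ 2, ∑ i, n i * p i, ∑ i, e i * n i, ∑ i, n i * x i;
         ∑ i, n i * p i, ∑ i, p i ^ 2, ∑ i, e i * p i, ∑ i, p i * x i;
         ∑ i, e i * n i, ∑ i, e i * p i, ∑ i, e i ^ 2, ∑ i, e i * x i;
         ∑ i, n i * x i, ∑ i, p i * x i, ∑ i, e i * x i, ∑ i, x i ^ 2] =
        (Matrix.of ![n, p, e, x]) * (Matrix.of ![n, p, e, x]).transpose := by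
      ext i j
      rw [Matrix.mul_apply]
      fin_cases i <;> fin_cases j <;> simp [Fin.sum_univ_four] <;> ring
    rw [hM, Matrix.det_mul, Matrix.det_transpose, ← sq]
    congr 1
    rw [det4]
    simp [Fin.sum_univ_succ, Matrix.det_succ_row_zero, Fin.succAbove]
    ring
  intro h1 h2
  rw [gram, h1, h2]
  generalize ∑ i, n i ^ 2 = A
  generalize ∑ i, p i ^ 2 = B
  generalize ∑ i, e i ^ 2 = C
  generalize ∑ i, x i ^ 2 = D
  generalize ∑ i, n i * p i = E
  generalize ∑ i, n i * x i = F
  generalize ∑ i, p i * x i = G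
  generalize ∑ i, e i * x i = H
  simp [Fin.sum_univ_succ, Matrix.det_succ_row_zero, Fin.succAbove]
  ring

lemma det4_sub (n p e x y : Fin 4 → ℤ) :
    det4 n p e (fun i => x i - y i) = det4 n p e x - det4 n p e y := by
  unfold det4; ring

lemma exists_orth (n p : Fin 4 → ℤ)
    (hd : 0 < (∑ i, n i ^ 2) * (∑ i, p i ^ 2) - (∑ i, n i * p i) ^ 2) :
    ∃ e : Fin 4 → ℤ, (∑ i, e i * n i = 0) ∧ (∑ i, e i * p i = 0) ∧ 0 < ∑ i, e i ^ 2 ∧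
      ∑ i, e i ^ 2 ≤ (∑ i, n i ^ 2) * (∑ i, p i ^ 2) - (∑ i, n i * p i) ^ 2 := by
  set P : Fin 4 → Fin 4 → ℤ := fun i j => n i * p j - n j * p i with hP
  have hdd : (∑ i, n i ^ 2) * (∑ i, p i ^ 2) - (∑ i, n i * p i) ^ 2 =
      P 0 1 ^ 2 + P 0 2 ^ 2 + P 0 3 ^ 2 + P 1 2 ^ 2 + P 1 3 ^ 2 + P 2 3 ^ 2 := by
    simp only [hP, Fin.sum_univ_four]; ring
  rw [hdd] at hd ⊢
  have s01 := sq_nonneg (P 0 1)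
  have s02 := sq_nonneg (P 0 2)
  have s03 := sq_nonneg (P 0 3)
  have s12 := sq_nonneg (P 1 2)
  have s13 := sq_nonneg (P 1 3)
  have s23 := sq_nonneg (P 2 3)
  by_cases c1 : 0 < P 2 3 ^ 2 + P 1 3 ^ 2 + P 1 2 ^ 2
  · refine ⟨![0, P 2 3, - P 1 3, P 1 2], ?_, ?_, ?_, ?_⟩
    · simp [Fin.sum_univ_four, hP]; ring
    · simp [Fin.sum_univ_four, hP]; ring
    · simp [Fin.sum_univ_four]; linarith
    · simp [Fin.sum_univ_four]; linarith
  by_cases c2 : 0 < P 1 2 ^ 2 + P 0 2 ^ 2 + P 0 1 ^ 2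
  · refine ⟨![P 1 2, - P 0 2, P 0 1, 0], ?_, ?_, ?_, ?_⟩
    · simp [Fin.sum_univ_four, hP]; ring
    · simp [Fin.sum_univ_four, hP]; ring
    · simp [Fin.sum_univ_four]; linarith
    · simp [Fin.sum_univ_four]; linarith
  · refine ⟨![P 2 3, 0, - P 0 3, P 0 2], ?_, ?_, ?_, ?_⟩
    · simp [Fin.sum_univ_four, hP]; ring
    · simp [Fin.sum_univ_four, hP]; ring
    · simp [Fin.sum_univ_four]; linarith
    · simp [Fin.sum_univ_four]; linarith

lemma gram_zero (n p x : Fin 4 → ℤ)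
    (hd : (∑ i, n i ^ 2) * (∑ i, p i ^ 2) - (∑ i, n i * p i) ^ 2 ≤ 0)
    (hn : 2 * ∑ i, n i * x i = ∑ i, n i ^ 2) (hp : 2 * ∑ i, p i * x i = ∑ i, p i ^ 2)
    (hn0 : n ≠ 0) (hp0 : p ≠ 0) : n = p := by
  have pos : ∀ q : Fin 4 → ℤ, q ≠ 0 → 0 < ∑ i, q i ^ 2 := by
    intro q hq
    obtain ⟨i, hi⟩ := Function.ne_iff.1 hq
    exact Finset.sum_pos' (fun i _ => sq_nonneg _) ⟨i, Finset.mem_univ _, by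
      have : q i ≠ 0 := hi
      positivity⟩
  have hA := pos n hn0
  have hB := pos p hp0
  set A := ∑ i, n i ^ 2 with hAd
  set B := ∑ i, p i ^ 2 with hBd
  set c := ∑ i, n i * p i with hcd
  have h1 : ∑ i, (B * n i - c * p i) ^ 2 = B * (A * B - c ^ 2) := by
    have : ∀ i, (B * n i - c * p i) ^ 2 =
        B ^ 2 * n i ^ 2 - 2 * B * c * (n i * p i) + c ^ 2 * p i ^ 2 := fun i => by ring
    simp_rw [this, Finset.sum_add_distrib, Finset.sum_sub_distrib, ← Finset.mul_sum]
    rw [← hAd, ← hBd, ← hcd]; ring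
  have h2 : ∑ i, (B * n i - c * p i) ^ 2 = 0 := by
    refine le_antisymm ?_ (Finset.sum_nonneg fun i _ => sq_nonneg _)
    rw [h1]; nlinarith
  have h3 : ∀ i, B * n i = c * p i := by
    intro i
    have := (Finset.sum_eq_zero_iff_of_nonneg (fun i _ => sq_nonneg _)).1 h2 i (Finset.mem_univ i)
    have := pow_eq_zero_iff (two_ne_zero) |>.1 this
    linarith
  have h4 : B * ∑ i, n i * x i = c * ∑ i, p i * x i := by
    rw [Finset.mul_sum, Finset.mul_sum]
    refine Finset.sum_congr rfl fun i _ => ?_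
    rw [← mul_assoc, h3 i, mul_assoc]
  have h5 : B * A = c * B := by linear_combination 2 * h4 - B * hn + c * hp
  have h6 : c = A := by
    have : B * A = B * c := by rw [h5]; ring
    exact (mul_left_cancel₀ hB.ne' this).symm
  have h7 : A * B = c ^ 2 := by
    rw [h1] at h2
    rcases mul_eq_zero.1 h2 with h | h
    · omega
    · linarith
  have h8 : B = A := by
    rw [h6, sq] at h7
    exact mul_left_cancel₀ hA.ne' h7
  funext i
  have := h3 i
  rw [h6, h8] at this
  exact mul_left_cancel₀ hA.ne' this

lemma circle_bound (ε : ℝ) (hε : 0 < ε) :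
    ∃ C : ℝ, 1 ≤ C ∧ ∀ m : ℕ, 0 < m → ∀ n p : Fin 4 → ℤ, n ≠ p → n ≠ 0 → p ≠ 0 →
      ∑ i, n i ^ 2 ≤ 4 * (m : ℤ) → ∑ i, p i ^ 2 ≤ 4 * (m : ℤ) →
      ∀ T : Finset (Fin 4 → ℤ), (∀ x ∈ T, ∑ i, x i ^ 2 = (m : ℤ) ∧
        2 * ∑ i, n i * x i = ∑ i, n i ^ 2 ∧ 2 * ∑ i, p i * x i = ∑ i, p i ^ 2) →
      (T.card : ℝ) ≤ C * (m : ℝ) ^ ε := by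
  obtain ⟨C, hC1, hC⟩ := divisor_bound (ε / 10) (by positivity)
  have h256 : (1 : ℝ) ≤ 256 ^ (ε / 10) := Real.one_le_rpow (by norm_num) (by positivity)
  have hbig : (1 : ℝ) ≤ 10 * (C * 256 ^ (ε / 10)) ^ 2 := by
    have : 1 ≤ C * 256 ^ (ε / 10) := one_le_mul_of_one_le_of_one_le hC1 h256
    nlinarith
  refine ⟨10 * (C * 256 ^ (ε / 10)) ^ 2, hbig, ?_⟩
  intro m hm n p hnp hn0 hp0 hn4 hp4 T hT
  have hm1 : (1 : ℝ) ≤ m := by exact_mod_cast hm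
  have hmε : (1 : ℝ) ≤ (m : ℝ) ^ ε := Real.one_le_rpow hm1 hε.le
  have hmz : (1 : ℤ) ≤ m := by exact_mod_cast hm
  have hone : T.card ≤ 1 → (T.card : ℝ) ≤ 10 * (C * 256 ^ (ε / 10)) ^ 2 * (m : ℝ) ^ ε := by
    intro h
    have : (T.card : ℝ) ≤ 1 := by exact_mod_cast h
    nlinarith
  rcases T.eq_empty_or_nonempty with rfl | ⟨x0, hx0⟩
  · exact hone (by simp)
  set d := (∑ i, n i ^ 2) * (∑ i, p i ^ 2) - (∑ i, n i * p i) ^ 2 with hd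
  have hdpos : 0 < d := by
    by_contra hcon
    obtain ⟨-, h1, h2⟩ := hT x0 hx0
    exact hnp (gram_zero n p x0 (not_lt.1 hcon) h1 h2 hn0 hp0)
  obtain ⟨e, he1, he2, hepos, hed⟩ := exists_orth n p hdpos
  rw [← hd] at hed
  have hA0 : 0 ≤ ∑ i, n i ^ 2 := Finset.sum_nonneg fun i _ => sq_nonneg _
  have hB0 : 0 ≤ ∑ i, p i ^ 2 := Finset.sum_nonneg fun i _ => sq_nonneg _
  have hd16 : d ≤ 16 * (m : ℤ) ^ 2 := by
    have : (∑ i, n i ^ 2) * (∑ i, p i ^ 2) ≤ (4 * (m : ℤ)) * (4 * m) :=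
      mul_le_mul hn4 hp4 hB0 (by positivity)
    rw [hd]; nlinarith [sq_nonneg (∑ i, n i * p i)]
  -- the constant
  set Nz := det4 n p e x0 ^ 2 + d * (∑ i, e i * x0 i) ^ 2 with hNz
  have hNconst : ∀ x ∈ T, det4 n p e x ^ 2 + d * (∑ i, e i * x i) ^ 2 = Nz := by
    intro x hx
    obtain ⟨a1, a2, a3⟩ := hT x hx
    obtain ⟨b1, b2, b3⟩ := hT x0 hx0
    have hα : ∑ i, n i * x i = ∑ i, n i * x0 i := by linarith
    have hβ : ∑ i, p i * x i = ∑ i, p i * x0 i := by linarith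
    rw [hNz, hd, gram4 n p e x he1 he2, gram4 n p e x0 he1 he2, a1, b1, hα, hβ]
  have hinj : ∀ x ∈ T, ∀ y ∈ T, det4 n p e x = det4 n p e y →
      ∑ i, e i * x i = ∑ i, e i * y i → x = y := by
    intro x hx y hy h1 h2
    obtain ⟨a1, a2, a3⟩ := hT x hx
    obtain ⟨b1, b2, b3⟩ := hT y hy
    have g := gram4 n p e (fun i => x i - y i) he1 he2
    have z1 : ∑ i, n i * (x i - y i) = 0 := by
      simp_rw [mul_sub, Finset.sum_sub_distrib]; linarith
    have z2 : ∑ i, p i * (x i - y i) = 0 := by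
      simp_rw [mul_sub, Finset.sum_sub_distrib]; linarith
    have z3 : ∑ i, e i * (x i - y i) = 0 := by
      simp_rw [mul_sub, Finset.sum_sub_distrib]; linarith
    rw [det4_sub, h1, z1, z2, z3, ← hd] at g
    have g' : (∑ i, e i ^ 2) * ((∑ i, (x i - y i) ^ 2) * d) = 0 := by
      rw [sub_self] at g; linarith
    have g2 : ∑ i, (x i - y i) ^ 2 = 0 := by
      rcases mul_eq_zero.1 g' with h | h
      · omega
      · rcases mul_eq_zero.1 h with h | h
        · exact h
        · omega
    funext i
    have := (Finset.sum_eq_zero_iff_of_nonneg (fun i _ => sq_nonneg _)).1 g2 i (Finset.mem_univ i)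
    have := pow_eq_zero_iff (two_ne_zero) |>.1 this
    linarith
  have hNbound : Nz ≤ 256 * (m : ℤ) ^ 5 := by
    obtain ⟨b1, b2, b3⟩ := hT x0 hx0
    have hB : 0 < ∑ i, p i ^ 2 := by
      rcases hB0.lt_or_eq with h | h
      · exact h
      · rw [hd, ← h] at hdpos
        nlinarith [sq_nonneg (∑ i, n i * p i)]
    rw [hNz, hd, gram4 n p e x0 he1 he2, b1, ← hd]
    set α := ∑ i, n i * x0 i
    set β := ∑ i, p i * x0 i
    set c := ∑ i, n i * p i
    set A := ∑ i, n i ^ 2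
    set B := ∑ i, p i ^ 2
    have hQ : 0 ≤ α ^ 2 * B - 2 * c * α * β + β ^ 2 * A := by
      have : B * (α ^ 2 * B - 2 * c * α * β + β ^ 2 * A) = (α * B - c * β) ^ 2 + d * β ^ 2 := by
        rw [hd]; ring
      have h2 : 0 ≤ B * (α ^ 2 * B - 2 * c * α * β + β ^ 2 * A) := by
        rw [this]; positivity
      exact nonneg_of_mul_nonneg_right h2 hB
    set Q := α ^ 2 * B - 2 * c * α * β + β ^ 2 * A
    calc (∑ i, e i ^ 2) * (m * d - Q) ≤ (∑ i, e i ^ 2) * (m * d) :=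
          mul_le_mul_of_nonneg_left (by linarith) hepos.le
      _ ≤ (16 * (m : ℤ) ^ 2) * (m * (16 * (m : ℤ) ^ 2)) := by
          refine mul_le_mul (hed.trans hd16) ?_ (by positivity) (by positivity)
          exact mul_le_mul_of_nonneg_left hd16 (by positivity)
      _ = 256 * (m : ℤ) ^ 5 := by ring
  have hNnn : 0 ≤ Nz := by rw [hNz]; positivity
  obtain ⟨N, hN⟩ := Int.eq_ofNat_of_zero_le hNnn
  obtain ⟨D, hD⟩ := Int.eq_ofNat_of_zero_le hdpos.le
  have hDpos : 0 < D := by omega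
  rcases Nat.eq_zero_or_pos N with hN0 | hNpos
  · refine hone (Finset.card_le_one.2 fun x hx y hy => ?_)
    have hz : ∀ x ∈ T, det4 n p e x = 0 ∧ ∑ i, e i * x i = 0 := by
      intro x hx
      have h := hNconst x hx
      rw [hN, hN0] at h
      have s1 := sq_nonneg (det4 n p e x)
      have s2 := sq_nonneg (∑ i, e i * x i)
      have s3 : 0 ≤ d * (∑ i, e i * x i) ^ 2 := by positivity
      simp only [Nat.cast_zero] at h
      refine ⟨pow_eq_zero_iff (two_ne_zero) |>.1 (by linarith), ?_⟩
      have : d * (∑ i, e i * x i) ^ 2 = 0 := by linarith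
      rcases mul_eq_zero.1 this with h | h
      · omega
      · exact pow_eq_zero_iff (two_ne_zero) |>.1 h
    exact hinj x hx y hy (by rw [(hz x hx).1, (hz y hy).1]) (by rw [(hz x hx).2, (hz y hy).2])
  have hcount := form_count D N hDpos hNpos (T.image fun x => (det4 n p e x, ∑ i, e i * x i)) ?_
  · rw [Finset.card_image_of_injOn] at hcount
    · have h1 : (T.card : ℝ) ≤ 10 * (N.divisors.card : ℝ) ^ 2 := by exact_mod_cast hcount
      have h2 := hC N hNpos
      have h3 : (N : ℝ) ≤ 256 * (m : ℝ) ^ 5 := by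
        rw [hN] at hNbound; exact_mod_cast hNbound
      have h4 : (N : ℝ) ^ (ε / 10) ≤ 256 ^ (ε / 10) * (m : ℝ) ^ (ε / 2) := by
        calc (N : ℝ) ^ (ε / 10) ≤ (256 * (m : ℝ) ^ 5) ^ (ε / 10) := by gcongr
          _ = 256 ^ (ε / 10) * (m : ℝ) ^ (ε / 2) := by
            rw [Real.mul_rpow (by norm_num) (by positivity), ← Real.rpow_natCast,
              ← Real.rpow_mul (by positivity)]
            congr 2; push_cast; ring
      have h5 : (N.divisors.card : ℝ) ≤ C * 256 ^ (ε / 10) * (m : ℝ) ^ (ε / 2) := by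
        rw [mul_assoc]
        exact h2.trans (mul_le_mul_of_nonneg_left h4 (by linarith))
      have h6 : ((m : ℝ) ^ (ε / 2)) ^ 2 = (m : ℝ) ^ ε := by
        rw [← Real.rpow_natCast, ← Real.rpow_mul (by positivity)]
        congr 1; push_cast; ring
      calc (T.card : ℝ) ≤ 10 * (N.divisors.card : ℝ) ^ 2 := h1
        _ ≤ 10 * (C * 256 ^ (ε / 10) * (m : ℝ) ^ (ε / 2)) ^ 2 := by gcongr
        _ = 10 * (C * 256 ^ (ε / 10)) ^ 2 * (m : ℝ) ^ ε := by rw [← h6]; ring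
    · intro x hx y hy h
      simp only [Prod.mk.injEq] at h
      exact hinj x hx y hy h.1 h.2
  · intro t ht
    obtain ⟨x, hx, rfl⟩ := Finset.mem_image.1 ht
    have := hNconst x hx
    rw [hN, hD] at this
    exact this

/-- Affine functionals on `ℝ⁴`. -/
def aff {ι : Type*} (ℓ : ι → (Fin 4 → ℝ) →ₗ[ℝ] ℝ) (c : ι → ℝ) (i : ι) (v : Fin 4 → ℝ) : ℝ :=
  ℓ i v + c i

/-- Real sign attached to a Boolean. -/
def sgnB (s : Bool) : SignType := if s then 1 else -1

/-- Encoding of a chain of sign vectors by a finite set. -/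
def encChain {ι : Type*} [Fintype ι] [DecidableEq ι] (φ : Fin 5 → ι → SignType) :
    Finset (ι × Fin 5 × Bool) :=
  Finset.univ.filter fun e => φ e.2.1 e.1 = sgnB e.2.2

lemma encChain_inj {ι : Type*} [Fintype ι] [DecidableEq ι] :
    Function.Injective (encChain (ι := ι)) := by
  intro φ ψ h
  funext k i
  have h1 : φ k i = 1 ↔ ψ k i = 1 := by
    have := Finset.ext_iff.1 h (i, k, true)
    simp only [encChain, Finset.mem_filter, Finset.mem_univ, true_and] at this
    simpa [sgnB] using this
  have h2 : φ k i = -1 ↔ ψ k i = -1 := by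
    have := Finset.ext_iff.1 h (i, k, false)
    simp only [encChain, Finset.mem_filter, Finset.mem_univ, true_and] at this
    simpa [sgnB] using this
  revert h1 h2
  generalize φ k i = a
  generalize ψ k i = b
  revert a b
  decide

lemma sgnB_ne (s : Bool) : ((sgnB s : SignType) : ℝ) ≠ 0 := by
  cases s <;> simp [sgnB]

lemma mul_sgn_nonpos (g x : ℝ) (s : Bool) (a : SignType) (hx : SignType.sign x = a)
    (h : (g * ((sgnB s : SignType) : ℝ) < 0 ∧ (a = 0 ∨ a = sgnB s)) ∨
      (0 < g * ((sgnB s : SignType) : ℝ) ∧ (a = 0 ∨ a ≠ sgnB s))) : g * x ≤ 0 := by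
  subst hx
  rcases lt_trichotomy x 0 with hx | hx | hx
  · rw [sign_neg hx] at h
    cases s <;> simp [sgnB] at h <;> nlinarith
  · simp [hx]
  · rw [sign_pos hx] at h
    cases s <;> simp [sgnB] at h
    · nlinarith
    · nlinarith

lemma mul_sgn_neg (g x : ℝ) (s : Bool) (hx : SignType.sign x = sgnB s)
    (h : g * ((sgnB s : SignType) : ℝ) < 0) : g * x < 0 := by
  cases s
  · simp [sgnB] at h hx
    nlinarith [sign_eq_neg_one_iff.1 hx]
  · simp [sgnB] at h hx
    nlinarith [sign_eq_one_iff.1 hx]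

lemma chain_shatter {ι : Type*} [Fintype ι] [DecidableEq ι]
    (ℓ : ι → (Fin 4 → ℝ) →ₗ[ℝ] ℝ) (c : ι → ℝ)
    (Φ : Finset (Fin 5 → ι → SignType))
    (hΦ : ∀ φ ∈ Φ, ∃ u : Fin 5 → Fin 4 → ℝ, (∀ k i, φ k i = SignType.sign (aff ℓ c i (u k))) ∧
      ∀ k k', k ≤ k' → ∀ i, φ k' i = 0 ∨ φ k' i = φ k i)
    (s : Finset (ι × Fin 5 × Bool)) (hs : (Φ.image encChain).Shatters s) : s.card ≤ 4 := by
  by_contra hcard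
  push Not at hcard
  -- a linear relation
  have hdep : ¬ LinearIndependent ℝ (fun e : s => ℓ e.1.1) := by
    intro hli
    have h1 := hli.fintype_card_le_finrank
    rw [Fintype.card_coe] at h1
    have h2 : Module.finrank ℝ ((Fin 4 → ℝ) →ₗ[ℝ] ℝ) = 4 := by
      rw [Module.finrank_linearMap]; simp
    omega
  rw [Fintype.not_linearIndependent_iff] at hdep
  obtain ⟨g, hg, ⟨e0, he0⟩, hge0⟩ := hdep
  set G : (ι × Fin 5 × Bool) → ℝ := fun e => if h : e ∈ s then g ⟨e, h⟩ else 0 with hG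
  have hGlin : ∀ v, ∑ e ∈ s, G e * ℓ e.1 v = 0 := by
    intro v
    have h1 := congrArg (fun L => L v) hg
    simp only [LinearMap.sum_apply, LinearMap.smul_apply, smul_eq_mul, LinearMap.zero_apply] at h1
    rw [← h1, ← Finset.sum_coe_sort s]
    refine Finset.sum_congr rfl fun e _ => ?_
    simp [hG]
  have hGe0 : G e0 ≠ 0 := by simp [hG, he0, hge0]
  -- the key contradiction
  obtain ⟨e1, he1, hmax⟩ := Finset.exists_max_image (s.filter fun e => G e ≠ 0) (fun e => e.2.1)
    ⟨e0, Finset.mem_filter.2 ⟨he0, hGe0⟩⟩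
  rw [Finset.mem_filter] at he1
  have key : ∀ H : (ι × Fin 5 × Bool) → ℝ, (∀ e ∈ s, H e = 0 ↔ G e = 0) →
      (∀ v, ∑ e ∈ s, H e * ℓ e.1 v = 0) → 0 ≤ ∑ e ∈ s, H e * c e.1 →
      (∑ e ∈ s, H e * c e.1 = 0 → H e1 * ((sgnB e1.2.2 : SignType) : ℝ) < 0) → False := by
    intro H hHG hHlin hκ hκ0
    obtain ⟨E, hE, hsE⟩ := hs (t := s.filter fun e => H e * ((sgnB e.2.2 : SignType) : ℝ) < 0)
      (Finset.filter_subset _ _)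
    obtain ⟨φ, hφ, rfl⟩ := Finset.mem_image.1 hE
    obtain ⟨u, hu, hmono⟩ := hΦ φ hφ
    have hmem : ∀ e ∈ s, (φ e.2.1 e.1 = sgnB e.2.2 ↔
        H e * ((sgnB e.2.2 : SignType) : ℝ) < 0) := by
      intro e he
      have := Finset.ext_iff.1 hsE e
      simpa [encChain, he] using this
    have hterm : ∀ e ∈ s, H e * aff ℓ c e.1 (u e1.2.1) ≤ 0 := by
      intro e he
      by_cases hH0 : H e = 0
      · simp [hH0]
      have hle : e.2.1 ≤ e1.2.1 := hmax e (Finset.mem_filter.2 ⟨he, fun h => hH0 ((hHG e he).2 h)⟩)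
      have hm := hmono _ _ hle e.1
      refine mul_sgn_nonpos _ _ e.2.2 _ (hu e1.2.1 e.1).symm ?_
      rcases lt_or_ge (H e * ((sgnB e.2.2 : SignType) : ℝ)) 0 with h | h
      · left
        refine ⟨h, ?_⟩
        rwa [(hmem e he).2 h] at hm
      · right
        refine ⟨lt_of_le_of_ne h ?_, ?_⟩
        · intro h0
          rcases mul_eq_zero.1 h0.symm with h | h
          · exact hH0 h
          · exact sgnB_ne _ h
        · rcases hm with hm | hm
          · exact Or.inl hm
          · right; rw [hm]; intro h2
            exact absurd ((hmem e he).1 h2) (not_lt.2 h)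
    have hsum : ∑ e ∈ s, H e * aff ℓ c e.1 (u e1.2.1) = ∑ e ∈ s, H e * c e.1 := by
      simp only [aff, mul_add, Finset.sum_add_distrib, hHlin, zero_add]
    have hle0 := Finset.sum_nonpos hterm
    rw [hsum] at hle0
    have h0 := le_antisymm hle0 hκ
    have hneg := hκ0 h0
    have hstrict : H e1 * aff ℓ c e1.1 (u e1.2.1) < 0 := by
      refine mul_sgn_neg _ _ e1.2.2 ?_ hneg
      rw [← hu]; exact (hmem e1 he1.1).2 hneg
    have := Finset.sum_lt_sum hterm ⟨e1, he1.1, hstrict⟩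
    rw [hsum, h0] at this
    simp at this
  have hne : G e1 * ((sgnB e1.2.2 : SignType) : ℝ) ≠ 0 := by
    exact mul_ne_zero he1.2 (sgnB_ne _)
  have hneg : ∀ F : (ι × Fin 5 × Bool) → ℝ,
      ∑ e ∈ s, (- G e) * F e = - ∑ e ∈ s, G e * F e := by
    intro F; simp [Finset.sum_neg_distrib]
  have keyN := key (fun e => - G e) (fun e _ => neg_eq_zero)
    (fun v => by rw [hneg (fun e => ℓ e.1 v), hGlin, neg_zero])
  have keyP := key G (fun e _ => Iff.rfl) hGlin
  simp only [hneg (fun e => c e.1)] at keyN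
  rcases lt_trichotomy (∑ e ∈ s, G e * c e.1) 0 with h | h | h
  · exact keyN (by linarith) (fun h' => by linarith)
  · rcases lt_or_gt_of_ne hne with h2 | h2
    · exact keyP h.ge (fun _ => h2)
    · exact keyN (by linarith) (fun _ => by linarith)
  · exact keyP h.le (fun h' => by linarith)

lemma chain_count {ι : Type*} [Fintype ι] [DecidableEq ι]
    (ℓ : ι → (Fin 4 → ℝ) →ₗ[ℝ] ℝ) (c : ι → ℝ)
    (Φ : Finset (Fin 5 → ι → SignType))
    (hΦ : ∀ φ ∈ Φ, ∃ u : Fin 5 → Fin 4 → ℝ, (∀ k i, φ k i = SignType.sign (aff ℓ c i (u k))) ∧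
      ∀ k k', k ≤ k' → ∀ i, φ k' i = 0 ∨ φ k' i = φ k i) :
    Φ.card ≤ (10 * Fintype.card ι + 1) ^ 4 := by
  rw [← Finset.card_image_of_injective Φ encChain_inj]
  refine (Finset.card_le_card_shatterer _).trans (Finset.card_shatterer_le_sum_vcDim.trans ?_)
  have hvc : (Φ.image encChain).vcDim ≤ 4 :=
    Finset.sup_le fun s hs => chain_shatter ℓ c Φ hΦ s (Finset.mem_shatterer.1 hs)
  have hcard : Fintype.card (ι × Fin 5 × Bool) = 10 * Fintype.card ι := by
    simp; ring
  rw [hcard]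
  set n := 10 * Fintype.card ι
  calc _ ≤ ∑ k ∈ Finset.Iic 4, n.choose k :=
        Finset.sum_le_sum_of_subset (Finset.Iic_subset_Iic.2 hvc)
    _ ≤ ∑ k ∈ Finset.Iic 4, n ^ k := Finset.sum_le_sum fun k _ => Nat.choose_le_pow n k
    _ = 1 + n + n ^ 2 + n ^ 3 + n ^ 4 := by
        have : Finset.Iic 4 = Finset.range 5 := by decide
        rw [this]; simp [Finset.sum_range_succ]
    _ ≤ (n + 1) ^ 4 := by
        have : (n + 1) ^ 4 = 1 + n + n ^ 2 + n ^ 3 + n ^ 4 + (3 * n + 5 * n ^ 2 + 3 * n ^ 3) := by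
          ring
        omega

/-- Greedy hitting sets. -/
lemma hitting {α β : Type*} [DecidableEq α] [DecidableEq β] (A : Finset α) (T : Finset β)
    (X : β → Finset α) (r : ℝ) (hr : 1 ≤ r)
    (hX : ∀ t ∈ T, X t ⊆ A ∧ (X t).Nonempty ∧ (A.card : ℝ) ≤ r * (X t).card) (n : ℕ) :
    ∃ S ⊆ A, S.card ≤ n ∧
      ((T.filter fun t => Disjoint (X t) S).card : ℝ) ≤ T.card * (1 - 1 / r) ^ n := by
  have hr0 : 0 < r := by linarith
  induction n with
  | zero => exact ⟨∅, by simp, by simp, by simp⟩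
  | succ n ih =>
    obtain ⟨S, hSA, hSn, hS⟩ := ih
    have hq0 : 0 ≤ 1 - 1 / r := by
      rw [sub_nonneg, div_le_one hr0]; exact hr
    set T' := T.filter fun t => Disjoint (X t) S with hT'
    rcases T'.eq_empty_or_nonempty with he | ⟨t0, ht0⟩
    · refine ⟨S, hSA, hSn.trans (Nat.le_succ n), ?_⟩
      rw [← hT', he, Finset.card_empty, Nat.cast_zero]
      exact mul_nonneg (Nat.cast_nonneg _) (pow_nonneg hq0 _)
    have ht0T := (Finset.mem_filter.1 ht0).1
    have hAne : A.Nonempty := (hX t0 ht0T).2.1.mono (hX t0 ht0T).1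
    have hA0 : (0 : ℝ) < A.card := by exact_mod_cast hAne.card_pos
    have hdouble : ∑ x ∈ A, ((T'.filter fun t => x ∈ X t).card : ℝ) = ∑ t ∈ T', ((X t).card : ℝ) := by
      have h1 := Finset.sum_card_bipartiteAbove_eq_sum_card_bipartiteBelow
        (s := A) (t := T') (fun x t => x ∈ X t)
      have h2 : ∀ t ∈ T', (Finset.bipartiteBelow (fun x t => x ∈ X t) A t) = X t := by
        intro t ht
        have := (hX t (Finset.mem_filter.1 ht).1).1
        ext x; simp [Finset.bipartiteBelow]; exact fun h => this h
      have h3 : ∑ t ∈ T', (Finset.bipartiteBelow (fun x t => x ∈ X t) A t).card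
          = ∑ t ∈ T', (X t).card := Finset.sum_congr rfl (fun t ht => by rw [h2 t ht])
      rw [h3] at h1
      exact_mod_cast h1
    have hlow : ∑ x ∈ A, (T'.card : ℝ) / r ≤ ∑ x ∈ A, ((T'.filter fun t => x ∈ X t).card : ℝ) := by
      rw [hdouble, Finset.sum_const, nsmul_eq_mul]
      have : ∀ t ∈ T', (A.card : ℝ) / r ≤ (X t).card := by
        intro t ht
        rw [div_le_iff₀ hr0, mul_comm]; exact (hX t (Finset.mem_filter.1 ht).1).2.2
      have h2 := Finset.sum_le_sum this
      rw [Finset.sum_const, nsmul_eq_mul] at h2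
      calc (A.card : ℝ) * (T'.card / r) = T'.card * (A.card / r) := by ring
        _ ≤ _ := h2
    obtain ⟨x, hxA, hx⟩ := Finset.exists_le_of_sum_le hAne hlow
    refine ⟨insert x S, Finset.insert_subset hxA hSA, (Finset.card_insert_le _ _).trans (by omega), ?_⟩
    have hsub : (T.filter fun t => Disjoint (X t) (insert x S)) ⊆ T'.filter fun t => ¬ x ∈ X t := by
      intro t ht
      rw [Finset.mem_filter, Finset.disjoint_insert_right] at ht
      rw [Finset.mem_filter, hT', Finset.mem_filter]
      exact ⟨⟨ht.1, ht.2.2⟩, ht.2.1⟩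
    have h3 := Finset.card_filter_add_card_filter_not (s := T') (fun t => x ∈ X t)
    have h3' : ((T'.filter fun t => x ∈ X t).card : ℝ) + ((T'.filter fun t => ¬ x ∈ X t).card : ℝ)
        = T'.card := by exact_mod_cast h3
    have h4 : ((T.filter fun t => Disjoint (X t) (insert x S)).card : ℝ) ≤
        (T'.filter fun t => ¬ x ∈ X t).card := by exact_mod_cast Finset.card_le_card hsub
    calc _ ≤ ((T'.filter fun t => ¬ x ∈ X t).card : ℝ) := h4
      _ ≤ T'.card * (1 - 1 / r) := by
          have : (T'.card : ℝ) * (1 - 1 / r) = T'.card - T'.card / r := by ring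
          rw [this]; linarith
      _ ≤ (T.card * (1 - 1 / r) ^ n) * (1 - 1 / r) := mul_le_mul_of_nonneg_right hS hq0
      _ = _ := by ring

lemma hitting' {α β : Type*} [DecidableEq α] [DecidableEq β] (A : Finset α) (T : Finset β)
    (X : β → Finset α) (r y : ℝ) (hr : 1 ≤ r) (hy : 1 ≤ y) (hTy : (T.card : ℝ) ≤ y)
    (hX : ∀ t ∈ T, X t ⊆ A ∧ (X t).Nonempty ∧ (A.card : ℝ) ≤ r * (X t).card) :
    ∃ S ⊆ A, (S.card : ℝ) ≤ r * Real.log y + 1 ∧ ∀ t ∈ T, ¬ Disjoint (X t) S := by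
  have hr0 : 0 < r := by linarith
  have hlog : 0 ≤ Real.log y := Real.log_nonneg hy
  obtain ⟨S, hSA, hSn, hS⟩ := hitting A T X r hr hX (⌊r * Real.log y⌋₊ + 1)
  set n := ⌊r * Real.log y⌋₊ + 1 with hn
  refine ⟨S, hSA, ?_, ?_⟩
  · have h1 : (S.card : ℝ) ≤ n := by exact_mod_cast hSn
    have h2 : (⌊r * Real.log y⌋₊ : ℝ) ≤ r * Real.log y := Nat.floor_le (by positivity)
    rw [hn] at h1; push_cast at h1; linarith
  · have hlt : r * Real.log y < n := by rw [hn]; push_cast; exact Nat.lt_floor_add_one _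
    have h1 : (1 - 1 / r) ^ n ≤ Real.exp (-(n / r)) := by
      have hb : 1 - 1 / r ≤ Real.exp (-(1 / r)) := by
        have := Real.add_one_le_exp (-(1 / r)); linarith
      have hq0 : 0 ≤ 1 - 1 / r := by
        rw [sub_nonneg, div_le_one hr0]; exact hr
      calc (1 - 1 / r) ^ n ≤ Real.exp (-(1 / r)) ^ n := by gcongr
        _ = _ := by rw [← Real.exp_nat_mul]; congr 1; ring
    have h2 : Real.exp (-(n / r)) < 1 / y := by
      have : Real.log y < n / r := by rw [lt_div_iff₀ hr0]; linarith
      have h5 : 1 / y = Real.exp (- Real.log y) := by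
        rw [Real.exp_neg, Real.exp_log (by linarith), one_div]
      rw [h5, Real.exp_lt_exp]; linarith
    have h3 : ((T.filter fun t => Disjoint (X t) S).card : ℝ) < 1 := by
      refine hS.trans_lt ?_
      have hq0 : 0 ≤ (1 - 1 / r) ^ n := by
        refine pow_nonneg ?_ n
        rw [sub_nonneg, div_le_one hr0]; exact hr
      calc (T.card : ℝ) * (1 - 1 / r) ^ n ≤ y * Real.exp (-(n / r)) := by gcongr
        _ < y * (1 / y) := by gcongr
        _ = 1 := by field_simp
    have h4 : (T.filter fun t => Disjoint (X t) S).card = 0 := by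
      have : (T.filter fun t => Disjoint (X t) S).card < 1 := by exact_mod_cast h3
      omega
    intro t ht hd
    have : t ∈ T.filter fun t => Disjoint (X t) S := Finset.mem_filter.2 ⟨ht, hd⟩
    rw [Finset.card_eq_zero.1 h4] at this
    simp at this

lemma aff_line {ι : Type*} (ℓ : ι → (Fin 4 → ℝ) →ₗ[ℝ] ℝ) (c : ι → ℝ) (i : ι)
    (v b : Fin 4 → ℝ) (s : ℝ) :
    aff ℓ c i (b + s • (v - b)) = aff ℓ c i b + s * (aff ℓ c i v - aff ℓ c i b) := by
  simp only [aff, map_add, map_smul, map_sub, smul_eq_mul]; ring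

lemma exit_pt {ι : Type*} (ℓ : ι → (Fin 4 → ℝ) →ₗ[ℝ] ℝ) (c : ι → ℝ) (S : Finset ι) (M : ℝ)
    (hbox : ∀ j : Fin 4, (∃ i ∈ S, ∀ v, aff ℓ c i v = v j - M) ∧
      ∃ i ∈ S, ∀ v, aff ℓ c i v = v j + M)
    (v b : Fin 4 → ℝ)
    (hs : ∀ i ∈ S, SignType.sign (aff ℓ c i b) = SignType.sign (aff ℓ c i v))
    (hne : b ≠ v) (hv : ∀ j, |v j| ≤ M) :
    ∃ (v' : Fin 4 → ℝ) (t : ℝ), 0 < t ∧ t < 1 ∧ v = (1 - t) • b + t • v' ∧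
      (∀ i ∈ S, SignType.sign (aff ℓ c i v') = 0 ∨
        SignType.sign (aff ℓ c i v') = SignType.sign (aff ℓ c i v)) ∧
      (∀ j, |v' j| ≤ M) ∧
      ∃ i0 ∈ S, aff ℓ c i0 v' = 0 ∧ aff ℓ c i0 v ≠ 0 := by
  classical
  have hz : ∀ i ∈ S, (aff ℓ c i v = 0 ↔ aff ℓ c i b = 0) := by
    intro i hi
    rw [← sign_eq_zero_iff, ← hs i hi, sign_eq_zero_iff]
  have hp : ∀ i ∈ S, (0 < aff ℓ c i v ↔ 0 < aff ℓ c i b) := by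
    intro i hi
    rw [← sign_eq_one_iff, ← hs i hi, sign_eq_one_iff]
  have hn : ∀ i ∈ S, (aff ℓ c i v < 0 ↔ aff ℓ c i b < 0) := by
    intro i hi
    rw [← sign_eq_neg_one_iff, ← hs i hi, sign_eq_neg_one_iff]
  set I := S.filter fun i => |aff ℓ c i v| < |aff ℓ c i b| with hI
  have hIne : I.Nonempty := by
    obtain ⟨j, hj⟩ := Function.ne_iff.1 hne
    have hvj := abs_le.1 (hv j)
    rcases lt_or_gt_of_ne hj with h | h
    · obtain ⟨i, hi, hf⟩ := (hbox j).1
      refine ⟨i, Finset.mem_filter.2 ⟨hi, ?_⟩⟩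
      rw [hf, hf, abs_of_nonpos (by linarith), abs_of_nonpos (by linarith)]; linarith
    · obtain ⟨i, hi, hf⟩ := (hbox j).2
      refine ⟨i, Finset.mem_filter.2 ⟨hi, ?_⟩⟩
      rw [hf, hf, abs_of_nonneg (by linarith), abs_of_nonneg (by linarith)]; linarith
  obtain ⟨i0, hi0, hmin⟩ := Finset.exists_min_image I
    (fun i => aff ℓ c i b / (aff ℓ c i b - aff ℓ c i v)) hIne
  obtain ⟨hi0S, hi0lt⟩ := Finset.mem_filter.1 hi0
  set s := aff ℓ c i0 b / (aff ℓ c i0 b - aff ℓ c i0 v) with hsdef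
  have hb0 : aff ℓ c i0 b ≠ 0 := by
    intro h; rw [h, abs_zero] at hi0lt; exact absurd hi0lt (not_lt.2 (abs_nonneg _))
  have hv0 : aff ℓ c i0 v ≠ 0 := fun h => hb0 ((hz i0 hi0S).1 h)
  have hd0 : aff ℓ c i0 b - aff ℓ c i0 v ≠ 0 := by
    intro h; rw [sub_eq_zero.1 h] at hi0lt; exact lt_irrefl _ hi0lt
  have hs1 : 1 < s := by
    rcases lt_or_gt_of_ne hv0 with h | h
    · have h' := (hn i0 hi0S).1 h
      rw [abs_of_neg h, abs_of_neg h'] at hi0lt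
      rw [hsdef, ← neg_div_neg_eq, lt_div_iff₀ (by linarith)]; linarith
    · have h' := (hp i0 hi0S).1 h
      rw [abs_of_pos h, abs_of_pos h'] at hi0lt
      rw [hsdef, lt_div_iff₀ (by linarith)]; linarith
  have hs0 : 0 < s := by linarith
  have hsigns : ∀ i ∈ S, SignType.sign (aff ℓ c i (b + s • (v - b))) = 0 ∨
        SignType.sign (aff ℓ c i (b + s • (v - b))) = SignType.sign (aff ℓ c i v) := by
    intro i hi
    rw [aff_line]
    rcases lt_trichotomy (aff ℓ c i v) 0 with h | h | h
    · have h' := (hn i hi).1 h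
      have hle : aff ℓ c i b + s * (aff ℓ c i v - aff ℓ c i b) ≤ 0 := by
        by_cases hlt : aff ℓ c i b < aff ℓ c i v
        · have := hmin i (Finset.mem_filter.2 ⟨hi, by
            rw [abs_of_neg h, abs_of_neg h']; linarith⟩)
          rw [← neg_div_neg_eq, le_div_iff₀ (by linarith)] at this
          nlinarith
        · nlinarith
      rcases hle.lt_or_eq with h2 | h2
      · right; rw [sign_neg h, sign_neg h2]
      · left; rw [h2, sign_zero]
    · left; rw [(hz i hi).1 h, h]; simp
    · have h' := (hp i hi).1 h
      have hle : 0 ≤ aff ℓ c i b + s * (aff ℓ c i v - aff ℓ c i b) := by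
        by_cases hlt : aff ℓ c i v < aff ℓ c i b
        · have := hmin i (Finset.mem_filter.2 ⟨hi, by
            rw [abs_of_pos h, abs_of_pos h']; linarith⟩)
          rw [le_div_iff₀ (by linarith)] at this
          nlinarith
        · nlinarith
      rcases hle.lt_or_eq with h2 | h2
      · right; rw [sign_pos h, sign_pos h2]
      · left; rw [← h2, sign_zero]
  refine ⟨b + s • (v - b), 1 / s, by positivity, by rw [div_lt_one hs0]; exact hs1, ?_,
    hsigns, ?_, i0, hi0S, ?_, hv0⟩
  · ext j; simp; field_simp; ring
  · intro j
    have hvj := abs_le.1 (hv j)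
    obtain ⟨⟨i, hi, hf⟩, ⟨i', hi', hf'⟩⟩ := hbox j
    rw [abs_le]
    constructor
    · have h1 := hsigns i' hi'
      by_contra hc
      push Not at hc
      have h2 : aff ℓ c i' (b + s • (v - b)) < 0 := by rw [hf']; linarith
      have h3 : 0 ≤ aff ℓ c i' v := by rw [hf']; linarith
      rw [sign_neg h2] at h1
      rcases h1 with h1 | h1
      · exact absurd h1 (by decide)
      · exact absurd (sign_eq_neg_one_iff.1 h1.symm) (not_lt.2 h3)
    · have h1 := hsigns i hi
      by_contra hc
      push Not at hc
      have h2 : 0 < aff ℓ c i (b + s • (v - b)) := by rw [hf]; linarith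
      have h3 : aff ℓ c i v ≤ 0 := by rw [hf]; linarith
      rw [sign_pos h2] at h1
      rcases h1 with h1 | h1
      · exact absurd h1 (by decide)
      · exact absurd (sign_eq_one_iff.1 h1.symm) (not_lt.2 h3)
  · rw [aff_line, hsdef]; field_simp; ring

/-- Directions along which the vanishing functionals of `S` stay zero. -/
def dirSpace {ι : Type*} (ℓ : ι → (Fin 4 → ℝ) →ₗ[ℝ] ℝ) (c : ι → ℝ) (S : Finset ι)
    (v : Fin 4 → ℝ) : Submodule ℝ (Fin 4 → ℝ) where
  carrier := {w | ∀ i ∈ S, aff ℓ c i v = 0 → ℓ i w = 0}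
  add_mem' := by
    intro a b ha hb i hi h
    rw [map_add, ha i hi h, hb i hi h, add_zero]
  zero_mem' := by intro i _ _; simp
  smul_mem' := by
    intro r a ha i hi h
    rw [map_smul, ha i hi h, smul_zero]

lemma flag {ι : Type*} (ℓ : ι → (Fin 4 → ℝ) →ₗ[ℝ] ℝ) (c : ι → ℝ) (S : Finset ι) (M : ℝ)
    (hbox : ∀ j : Fin 4, (∃ i ∈ S, ∀ v, aff ℓ c i v = v j - M) ∧
      ∃ i ∈ S, ∀ v, aff ℓ c i v = v j + M)
    (b : (Fin 4 → ℝ) → Fin 4 → ℝ)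
    (hb : ∀ v, ∀ i ∈ S, SignType.sign (aff ℓ c i (b v)) = SignType.sign (aff ℓ c i v)) (d : ℕ) :
    ∀ v : Fin 4 → ℝ, (∀ j, |v j| ≤ M) → Module.finrank ℝ (dirSpace ℓ c S v) ≤ d →
    ∃ u : ℕ → Fin 4 → ℝ, u 0 = v ∧
      (∀ k, ∀ i ∈ S, SignType.sign (aff ℓ c i (u (k + 1))) = 0 ∨
        SignType.sign (aff ℓ c i (u (k + 1))) = SignType.sign (aff ℓ c i (u k))) ∧
      ∀ (L : (Fin 4 → ℝ) →ₗ[ℝ] ℝ) (e : ℝ), (∀ k ≤ d, 0 ≤ L (b (u k)) + e) →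
        0 ≤ L v + e ∧ (L v + e = 0 ↔ ∀ k ≤ d, L (b (u k)) + e = 0) := by
  have hmem : ∀ v, v - b v ∈ dirSpace ℓ c S v := by
    intro v i hi h
    have h2 : aff ℓ c i (b v) = 0 := by
      rw [← sign_eq_zero_iff, hb v i hi, h, sign_zero]
    rw [map_sub]
    simp only [aff] at h h2
    linarith
  have hconst : ∀ (d : ℕ) (v : Fin 4 → ℝ), b v = v → ∃ u : ℕ → Fin 4 → ℝ, u 0 = v ∧
      (∀ k, ∀ i ∈ S, SignType.sign (aff ℓ c i (u (k + 1))) = 0 ∨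
        SignType.sign (aff ℓ c i (u (k + 1))) = SignType.sign (aff ℓ c i (u k))) ∧
      ∀ (L : (Fin 4 → ℝ) →ₗ[ℝ] ℝ) (e : ℝ), (∀ k ≤ d, 0 ≤ L (b (u k)) + e) →
        0 ≤ L v + e ∧ (L v + e = 0 ↔ ∀ k ≤ d, L (b (u k)) + e = 0) := by
    intro d v hv
    refine ⟨fun _ => v, rfl, fun _ _ _ => Or.inr rfl, fun L e h => ?_⟩
    simp only [hv] at h ⊢
    exact ⟨h 0 (Nat.zero_le _), fun h' _ _ => h', fun h' => h' 0 (Nat.zero_le _)⟩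
  induction d with
  | zero =>
    intro v hv hd
    refine hconst 0 v ?_
    have h0 : dirSpace ℓ c S v = ⊥ := Submodule.finrank_eq_zero.1 (Nat.le_zero.1 hd)
    have := hmem v
    rw [h0, Submodule.mem_bot, sub_eq_zero] at this
    exact this.symm
  | succ d ih =>
    intro v hv hd
    by_cases hbv : b v = v
    · exact hconst _ v hbv
    obtain ⟨v', t, ht0, ht1, hvt, hsg, hv', i0, hi0, hi0z, hi0v⟩ :=
      exit_pt ℓ c S M hbox v (b v) (hb v) hbv hv
    have hlt : dirSpace ℓ c S v' < dirSpace ℓ c S v := by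
      refine lt_of_le_of_ne ?_ ?_
      · intro w hw i hi h
        refine hw i hi ?_
        have := hsg i hi
        rw [h, sign_zero, or_self, sign_eq_zero_iff] at this
        exact this
      · intro heq
        have h1 := hmem v
        rw [← heq] at h1
        have h2 := h1 i0 hi0 hi0z
        rw [map_sub] at h2
        have h3 : aff ℓ c i0 v = (1 - t) * aff ℓ c i0 (b v) + t * aff ℓ c i0 v' := by
          conv_lhs => rw [hvt]
          simp only [aff, map_add, map_smul, smul_eq_mul]; ring
        have h4 : aff ℓ c i0 (b v) = aff ℓ c i0 v := by simp only [aff]; linarith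
        rw [hi0z, h4] at h3
        have : t * aff ℓ c i0 v = 0 := by linarith
        rcases mul_eq_zero.1 this with h | h
        · linarith
        · exact hi0v h
    have hfr := Submodule.finrank_lt_finrank_of_lt hlt
    obtain ⟨u, hu0, humono, hu⟩ := ih v' hv' (by omega)
    refine ⟨fun k => Nat.casesOn k v u, rfl, ?_, ?_⟩
    · intro k i hi
      cases k with
      | zero => simpa [hu0] using hsg i hi
      | succ k => exact humono k i hi
    · intro L e h
      have hLv : L v + e = (1 - t) * (L (b v) + e) + t * (L v' + e) := by
        conv_lhs => rw [hvt]
        simp only [map_add, map_smul, smul_eq_mul]; ring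
      have h0 : 0 ≤ L (b v) + e := h 0 (Nat.zero_le _)
      obtain ⟨h1, h2⟩ := hu L e (fun k hk => h (k + 1) (by omega))
      have ht1' : 0 < 1 - t := by linarith
      have hA := mul_nonneg ht1'.le h0
      have hB := mul_nonneg ht0.le h1
      refine ⟨by rw [hLv]; exact add_nonneg hA hB, ?_⟩
      constructor
      · intro hz
        rw [hLv] at hz
        have hA0 : (1 - t) * (L (b v) + e) = 0 := by linarith
        have hB0 : t * (L v' + e) = 0 := by linarith
        have hA1 := (mul_eq_zero.1 hA0).resolve_left ht1'.ne'
        have hB1 := (mul_eq_zero.1 hB0).resolve_left ht0.ne'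
        intro k hk
        cases k with
        | zero => exact hA1
        | succ k => exact h2.1 hB1 k (by omega)
      · intro hz
        rw [hLv]
        have hA1 : L (b v) + e = 0 := hz 0 (Nat.zero_le _)
        have hB1 := h2.2 (fun k hk => hz (k + 1) (by omega))
        rw [hA1, hB1]; ring

/-- The box functionals added to the family. -/
def extL {α : Type*} (ℓ : α → (Fin 4 → ℝ) →ₗ[ℝ] ℝ) : α ⊕ (Fin 4 × Bool) → (Fin 4 → ℝ) →ₗ[ℝ] ℝ
  | Sum.inl x => ℓ x
  | Sum.inr j => LinearMap.proj j.1

/-- The constants of the box functionals added to the family. -/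
def extC {α : Type*} (c : α → ℝ) (M : ℝ) : α ⊕ (Fin 4 × Bool) → ℝ
  | Sum.inl x => c x
  | Sum.inr j => if j.2 then M else -M

lemma cutting {α : Type*} [Fintype α] [DecidableEq α]
    (ℓ : α → (Fin 4 → ℝ) →ₗ[ℝ] ℝ) (c : α → ℝ) (P : Finset (Fin 4 → ℝ)) (r : ℝ) (hr : 1 ≤ r) :
    ∃ Qs : Finset (Finset (Fin 4 → ℝ)), (∀ v ∈ P, ∃ Q ∈ Qs, v ∈ Q) ∧
      (Qs.card : ℝ) ≤ (200 * r * Real.log (10 * (Fintype.card α + 8) + 1) + 91) ^ 4 ∧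
      ∀ Q ∈ Qs, Q ⊆ P ∧ ∃ X : Finset α, r * X.card ≤ Fintype.card α ∧
        ∀ x ∉ X, ∀ v ∈ Q, ∀ w ∈ Q, (aff ℓ c x v = 0 ↔ aff ℓ c x w = 0) := by
  classical
  set M : ℝ := ∑ v ∈ P, ∑ j, |v j| with hM
  have hPM : ∀ v ∈ P, ∀ j, |v j| ≤ M := by
    intro v hv j
    calc |v j| ≤ ∑ j, |v j| :=
          Finset.single_le_sum (f := fun j => |v j|) (fun _ _ => abs_nonneg _) (Finset.mem_univ j)
      _ ≤ M := Finset.single_le_sum (f := fun v : Fin 4 → ℝ => ∑ j, |v j|)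
          (fun _ _ => Finset.sum_nonneg fun _ _ => abs_nonneg _) hv
  set E := extL ℓ with hE
  set D := extC c M with hD
  set y : ℝ := 10 * (Fintype.card α + 8) + 1 with hy
  have hy1 : 1 ≤ y := by rw [hy]; linarith [(Nat.cast_nonneg (Fintype.card α) : (0:ℝ) ≤ _)]
  have hcardι : Fintype.card (α ⊕ (Fin 4 × Bool)) = Fintype.card α + 8 := by simp
  set sgnA : (Fin 4 → ℝ) → (α ⊕ (Fin 4 × Bool)) → SignType :=
    fun v i => SignType.sign (aff E D i v) with hsgnA
  set SV : Finset ((α ⊕ (Fin 4 × Bool)) → SignType) :=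
    Finset.univ.filter fun σ => ∃ v, σ = sgnA v with hSV
  have hSVcard : (SV.card : ℝ) ≤ y ^ 4 := by
    have h1 := chain_count E D (SV.image fun σ (_ : Fin 5) => σ) (by
      intro φ hφ
      obtain ⟨σ, hσ, rfl⟩ := Finset.mem_image.1 hφ
      obtain ⟨v, rfl⟩ := (Finset.mem_filter.1 hσ).2
      exact ⟨fun _ => v, fun _ _ => rfl, fun _ _ _ _ => Or.inr rfl⟩)
    rw [Finset.card_image_of_injective _ (fun a b h => congrFun h 0), hcardι] at h1
    have : ((SV.card : ℕ) : ℝ) ≤ (((10 * (Fintype.card α + 8) + 1) ^ 4 : ℕ) : ℝ) := by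
      exact_mod_cast h1
    rw [hy]; push_cast at this; exact this
  set T : Finset (Fin 5 → (α ⊕ (Fin 4 × Bool)) → SignType) := Fintype.piFinset fun _ => SV with hT
  set Xf : (Fin 5 → (α ⊕ (Fin 4 × Bool)) → SignType) → Finset α := fun t =>
    Finset.univ.filter fun x => (∃ k, t k (Sum.inl x) = 1) ∧ ∃ k, t k (Sum.inl x) = -1 with hXf
  have hTcard : (T.card : ℝ) ≤ y ^ 20 := by
    rw [hT, Fintype.card_piFinset]
    simp only [Finset.prod_const, Finset.card_univ, Fintype.card_fin]
    push_cast
    calc (SV.card : ℝ) ^ 5 ≤ (y ^ 4) ^ 5 := by gcongr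
      _ = y ^ 20 := by ring
  set Bad := T.filter fun t => (Fintype.card α : ℝ) < r * (Xf t).card with hBad
  obtain ⟨S0, -, hS0c, hS0⟩ := hitting' (Finset.univ : Finset α) Bad Xf r (y ^ 20) hr
    (one_le_pow₀ hy1)
    (le_trans (by exact_mod_cast Finset.card_le_card (Finset.filter_subset _ _)) hTcard) (by
      intro t ht
      have h := (Finset.mem_filter.1 ht).2
      refine ⟨Finset.subset_univ _, ?_, ?_⟩
      · rw [Finset.nonempty_iff_ne_empty]
        intro h0
        rw [h0] at h
        simp at h
        exact absurd h (not_lt.2 (Nat.cast_nonneg _))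
      · rw [Finset.card_univ]; exact h.le)
  rw [Real.log_pow] at hS0c
  set S : Finset (α ⊕ (Fin 4 × Bool)) := Finset.disjSum S0 Finset.univ with hS
  have hScard : S.card = S0.card + 8 := by rw [hS, Finset.card_disjSum]; simp
  have hbox : ∀ j : Fin 4, (∃ i ∈ S, ∀ v, aff E D i v = v j - M) ∧
      ∃ i ∈ S, ∀ v, aff E D i v = v j + M := by
    intro j
    refine ⟨⟨Sum.inr (j, false), ?_, ?_⟩, ⟨Sum.inr (j, true), ?_, ?_⟩⟩
    · simp [hS]
    · intro v; simp [aff, hE, hD, extL, extC]; ring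
    · simp [hS]
    · intro v; simp [aff, hE, hD, extL, extC]
  set sgnS : (Fin 4 → ℝ) → S → SignType := fun v i => SignType.sign (aff E D i.1 v) with hsgnS
  set pick : (S → SignType) → Fin 4 → ℝ := Function.invFun sgnS with hpick
  have hpk : ∀ v, sgnS (pick (sgnS v)) = sgnS v := fun v => Function.invFun_eq ⟨v, rfl⟩
  have hflag : ∀ v : Fin 4 → ℝ, v ∈ P → ∃ u : ℕ → Fin 4 → ℝ,
      (∀ k, ∀ i ∈ S, SignType.sign (aff E D i (u (k + 1))) = 0 ∨
        SignType.sign (aff E D i (u (k + 1))) = SignType.sign (aff E D i (u k))) ∧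
      ∀ (L : (Fin 4 → ℝ) →ₗ[ℝ] ℝ) (e : ℝ), (∀ k ≤ 4, 0 ≤ L (pick (sgnS (u k))) + e) →
        (L v + e = 0 ↔ ∀ k ≤ 4, L (pick (sgnS (u k))) + e = 0) := by
    intro v hv
    obtain ⟨u, -, h1, h2⟩ := flag E D S M hbox (fun v => pick (sgnS v))
      (fun v i hi => congrFun (hpk v) ⟨i, hi⟩) 4 v (hPM v hv)
      ((Submodule.finrank_le _).trans (by simp))
    exact ⟨u, h1, fun L e h => (h2 L e h).2⟩
  choose! u hu1 hu2 using hflag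
  have hmono : ∀ v ∈ P, ∀ i ∈ S, ∀ k k', k ≤ k' → SignType.sign (aff E D i (u v k')) = 0 ∨
        SignType.sign (aff E D i (u v k')) = SignType.sign (aff E D i (u v k)) := by
    intro v hv i hi k k' hkk
    induction k', hkk using Nat.le_induction with
    | base => exact Or.inr rfl
    | succ k' _ ih =>
      rcases hu1 v hv k' i hi with h | h
      · exact Or.inl h
      · rw [h]; exact ih
  set φ : (Fin 4 → ℝ) → Fin 5 → S → SignType := fun v k => sgnS (u v k) with hφ
  refine ⟨(P.image φ).image fun ψ => P.filter fun w => φ w = ψ, ?_, ?_, ?_⟩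
  · intro v hv
    exact ⟨_, Finset.mem_image_of_mem _ (Finset.mem_image_of_mem _ hv),
      Finset.mem_filter.2 ⟨hv, rfl⟩⟩
  · have h1 := chain_count (fun i : S => E i.1) (fun i : S => D i.1) (P.image φ) (by
      intro ψ hψ
      obtain ⟨v, hv, rfl⟩ := Finset.mem_image.1 hψ
      exact ⟨fun k => u v k, fun _ _ => rfl, fun k k' hkk i => hmono v hv i.1 i.2 k k' hkk⟩)
    rw [Fintype.card_coe, hScard] at h1
    have h2 : ((((P.image φ).image fun ψ => P.filter fun w => φ w = ψ).card : ℕ) : ℝ) ≤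
        (((10 * (S0.card + 8) + 1) ^ 4 : ℕ) : ℝ) := by
      exact_mod_cast Finset.card_image_le.trans h1
    refine h2.trans ?_
    push_cast
    refine pow_le_pow_left₀ (by positivity) ?_ 4
    push_cast at hS0c
    linarith
  · intro Q hQ
    obtain ⟨ψ, hψ, rfl⟩ := Finset.mem_image.1 hQ
    obtain ⟨v0, hv0, rfl⟩ := Finset.mem_image.1 hψ
    refine ⟨Finset.filter_subset _ _, ?_⟩
    set t : Fin 5 → (α ⊕ (Fin 4 × Bool)) → SignType := fun k => sgnA (pick (φ v0 k)) with ht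
    have htT : t ∈ T := by
      rw [hT, Fintype.mem_piFinset]
      intro k
      exact Finset.mem_filter.2 ⟨Finset.mem_univ _, _, rfl⟩
    have htS : ∀ k, ∀ i, ∀ hi : i ∈ S, t k i = SignType.sign (aff E D i (u v0 k)) := by
      intro k i hi
      exact congrFun (hpk (u v0 k)) ⟨i, hi⟩
    refine ⟨Xf t, ?_, ?_⟩
    · by_contra hc
      push Not at hc
      have hnd := hS0 t (Finset.mem_filter.2 ⟨htT, hc⟩)
      rw [Finset.not_disjoint_iff] at hnd
      obtain ⟨x, hx, hxS⟩ := hnd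
      have hxS' : (Sum.inl x : α ⊕ (Fin 4 × Bool)) ∈ S := by simp [hS, hxS]
      obtain ⟨-, ⟨k, hk⟩, ⟨k', hk'⟩⟩ := Finset.mem_filter.1 hx
      rw [htS k _ hxS'] at hk
      rw [htS k' _ hxS'] at hk'
      rcases le_total (k : ℕ) (k' : ℕ) with h | h
      · have := hmono v0 hv0 _ hxS' _ _ h
        rw [hk, hk'] at this
        revert this; decide
      · have := hmono v0 hv0 _ hxS' _ _ h
        rw [hk, hk'] at this
        revert this; decide
    · intro x hx
      have hiff : ∀ v ∈ P.filter (fun w => φ w = φ v0),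
          (aff ℓ c x v = 0 ↔ ∀ k : Fin 5, t k (Sum.inl x) = 0) := by
        intro v hv
        obtain ⟨hvP, hvφ⟩ := Finset.mem_filter.1 hv
        have hpe : ∀ k : Fin 5, pick (sgnS (u v k)) = pick (φ v0 k) := by
          intro k; rw [← hvφ]
        have hta : ∀ k : Fin 5, t k (Sum.inl x) = SignType.sign (ℓ x (pick (φ v0 k)) + c x) :=
          fun k => rfl
        have hx' : (∀ k, t k (Sum.inl x) ≠ -1) ∨ ∀ k, t k (Sum.inl x) ≠ 1 := by
          by_contra hcon
          push Not at hcon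
          exact hx (Finset.mem_filter.2 ⟨Finset.mem_univ _, hcon.2, hcon.1⟩)
        rcases hx' with hx' | hx'
        · have h := hu2 v hvP (ℓ x) (c x) (by
            intro k hk
            have h1 := hx' ⟨k, by omega⟩
            rw [hta, ← hpe] at h1
            by_contra hneg
            exact h1 (sign_neg (not_le.1 hneg)))
          rw [aff, h]
          constructor
          · intro h k
            rw [hta, ← hpe, h k (by omega), sign_zero]
          · intro h k hk
            have := h ⟨k, by omega⟩
            rw [hta, ← hpe, sign_eq_zero_iff] at this
            exact this
        · have h := hu2 v hvP (-ℓ x) (-c x) (by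
            intro k hk
            have h1 := hx' ⟨k, by omega⟩
            rw [hta, ← hpe] at h1
            by_contra hneg
            refine h1 (sign_pos ?_)
            simp only [LinearMap.neg_apply] at hneg
            linarith)
          simp only [LinearMap.neg_apply] at h
          have e1 : ∀ a b : ℝ, -a + -b = 0 ↔ a + b = 0 := by
            intro a b; constructor <;> intro h <;> linarith
          simp only [e1] at h
          rw [aff, h]
          constructor
          · intro h k
            rw [hta, ← hpe, h k (by omega), sign_zero]
          · intro h k hk
            have := h ⟨k, by omega⟩
            rw [hta, ← hpe, sign_eq_zero_iff] at this
            exact this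
      intro v hv w hw
      rw [hiff v hv, hiff w hw]

lemma union_lower {α β : Type*} [DecidableEq α] [DecidableEq β] (Z : β → Finset α) (a s : ℝ)
    (hs : 0 ≤ s) (X : Finset α) (F : Finset β) (hX : ∀ n ∈ F, Z n ⊆ X)
    (ha : ∀ n ∈ F, a ≤ (Z n).card)
    (hp : ∀ n ∈ F, ∀ p ∈ F, n ≠ p → ((Z n ∩ Z p).card : ℝ) ≤ s) :
    (F.card : ℝ) * (a - s * F.card) ≤ X.card := by
  have key : (F.card : ℝ) * (a - s * F.card) ≤ (F.biUnion Z).card := by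
    clear hX
    induction F using Finset.induction_on with
    | empty => simp
    | insert n F hn ih =>
      have ih' := ih (fun p hp' => ha p (Finset.mem_insert_of_mem hp'))
        (fun p hp' q hq => hp p (Finset.mem_insert_of_mem hp') q (Finset.mem_insert_of_mem hq))
      have h1 : ((Z n ∩ F.biUnion Z).card : ℝ) ≤ F.card * s := by
        rw [Finset.inter_biUnion]
        have h2 : (((F.biUnion fun x => Z n ∩ Z x).card : ℕ) : ℝ) ≤
            ((∑ x ∈ F, (Z n ∩ Z x).card : ℕ) : ℝ) := by exact_mod_cast Finset.card_biUnion_le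
        refine h2.trans ?_
        push_cast
        calc ∑ x ∈ F, ((Z n ∩ Z x).card : ℝ) ≤ ∑ x ∈ F, s := Finset.sum_le_sum fun x hx =>
              hp n (Finset.mem_insert_self _ _) x (Finset.mem_insert_of_mem hx)
                (fun h => hn (h ▸ hx))
          _ = F.card * s := by simp
      have h3 := Finset.card_union_add_card_inter (Z n) (F.biUnion Z)
      have h3' : ((Z n ∪ F.biUnion Z).card : ℝ) + (Z n ∩ F.biUnion Z).card
          = (Z n).card + (F.biUnion Z).card := by exact_mod_cast h3
      have h4 := ha n (Finset.mem_insert_self _ _)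
      rw [Finset.biUnion_insert, Finset.card_insert_of_notMem hn]
      push_cast
      nlinarith [(Nat.cast_nonneg F.card : (0 : ℝ) ≤ _)]
  refine key.trans ?_
  exact_mod_cast Finset.card_le_card (Finset.biUnion_subset.2 hX)

lemma union_lower' {α β : Type*} [DecidableEq α] [DecidableEq β] (Z : β → Finset α) (a s : ℝ)
    (hs : 0 ≤ s) (X : Finset α) (F : Finset β) (hX : ∀ n ∈ F, Z n ⊆ X)
    (ha : ∀ n ∈ F, a ≤ (Z n).card)
    (hp : ∀ n ∈ F, ∀ p ∈ F, n ≠ p → ((Z n ∩ Z p).card : ℝ) ≤ s) (q : ℕ) (hq : q ≤ F.card) :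
    (q : ℝ) * (a - s * q) ≤ X.card := by
  obtain ⟨G, hG, hGq⟩ := Finset.exists_subset_card_eq hq
  have := union_lower Z a s hs X G (fun n hn => hX n (hG hn)) (fun n hn => ha n (hG hn))
    (fun n hn p hp' => hp n (hG hn) p (hG hp'))
  rwa [hGq] at this

/-- The points on the hyperplane dual to `v`. -/
def zeroSet {α : Type*} [Fintype α] (ℓ : α → (Fin 4 → ℝ) →ₗ[ℝ] ℝ) (c : α → ℝ)
    (v : Fin 4 → ℝ) : Finset α := by
  classical exact Finset.univ.filter fun x => aff ℓ c x v = 0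

lemma mem_zeroSet {α : Type*} [Fintype α] (ℓ : α → (Fin 4 → ℝ) →ₗ[ℝ] ℝ) (c : α → ℝ)
    (v : Fin 4 → ℝ) (x : α) : x ∈ zeroSet ℓ c v ↔ aff ℓ c x v = 0 := by
  simp [zeroSet]

lemma incidence {α : Type*} [Fintype α] [DecidableEq α]
    (ℓ : α → (Fin 4 → ℝ) →ₗ[ℝ] ℝ) (c : α → ℝ) (P : Finset (Fin 4 → ℝ)) (s τ : ℝ) (hs : 1 ≤ s)
    (hτ : 4 * s ≤ τ) (hbig : ∀ v ∈ P, τ ≤ (zeroSet ℓ c v).card)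
    (hpair : ∀ v ∈ P, ∀ w ∈ P, v ≠ w → ((zeroSet ℓ c v ∩ zeroSet ℓ c w).card : ℝ) ≤ s) :
    (P.card : ℝ) * τ ≤ 2 * Fintype.card α ∨
    (P.card : ℝ) * τ ^ 7 ≤
      (9312 * s * Real.log (10 * (Fintype.card α + 8) + 1) * Fintype.card α) ^ 4 := by
  classical
  set N : ℝ := (Fintype.card α : ℝ) with hN
  have hN0 : 0 ≤ N := Nat.cast_nonneg _
  set Λ := Real.log (10 * (N + 8) + 1) with hΛ
  have hs0 : 0 < s := by linarith
  have hτ0 : 0 < τ := by linarith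
  have hΛ1 : 1 ≤ Λ := by
    rw [hΛ, Real.le_log_iff_exp_le (by linarith)]
    have := Real.exp_one_lt_d9
    linarith
  set q := ⌊τ / (2 * s)⌋₊ with hq
  have hq1 : (q : ℝ) ≤ τ / (2 * s) := Nat.floor_le (by positivity)
  have hq2 : τ / (2 * s) < q + 1 := Nat.lt_floor_add_one _
  have hsq : s * q ≤ τ / 2 := by
    rw [le_div_iff₀ (by positivity)] at hq1; linarith
  have hqlow : τ ≤ 4 * s * q := by
    rw [div_lt_iff₀ (by positivity)] at hq2
    nlinarith
  rcases lt_or_ge (32 * s * N / τ ^ 2) 1 with hr | hr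
  · left
    rw [div_lt_one (by positivity)] at hr
    have hlt : P.card < q := by
      by_contra hc
      push Not at hc
      have h1 := union_lower' (zeroSet ℓ c) τ s hs0.le Finset.univ P (fun _ _ => Finset.subset_univ _)
        hbig hpair q hc
      rw [Finset.card_univ, ← hN] at h1
      have h2 : (q : ℝ) * (τ / 2) ≤ N := le_trans (by gcongr; linarith) h1
      nlinarith [mul_le_mul_of_nonneg_right hqlow hτ0.le, mul_le_mul_of_nonneg_left h2 hs0.le]
    have h1 := union_lower (zeroSet ℓ c) τ s hs0.le Finset.univ P (fun _ _ => Finset.subset_univ _)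
        hbig hpair
    rw [Finset.card_univ, ← hN] at h1
    have h3 : (P.card : ℝ) ≤ q := by exact_mod_cast hlt.le
    have h4 : s * P.card ≤ τ / 2 := le_trans (by gcongr) hsq
    have h2 : (P.card : ℝ) * (τ / 2) ≤ N := le_trans (by gcongr; linarith) h1
    linarith
  · right
    set r := 32 * s * N / τ ^ 2 with hrdef
    obtain ⟨Qs, hcov, hcard, hQs⟩ := cutting ℓ c P r hr
    rw [← hN, ← hΛ] at hcard
    have hpart : ∀ Q ∈ Qs, (Q.card : ℝ) ≤ τ := by
      intro Q hQ
      obtain ⟨hQP, X, hX, hXc⟩ := hQs Q hQ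
      rcases Nat.lt_or_ge 1 Q.card with hQ1 | hQ1
      · have hXle : (X.card : ℝ) * (32 * s) ≤ τ ^ 2 := by
          rw [← hN, hrdef, div_mul_eq_mul_div, div_le_iff₀ (by positivity)] at hX
          have hNpos : 0 < N := by
            rcases hN0.lt_or_eq with h | h
            · exact h
            · rw [hrdef, ← h] at hr; simp at hr; linarith
          have : N * ((X.card : ℝ) * (32 * s)) ≤ N * τ ^ 2 := by linarith
          exact le_of_mul_le_mul_left this hNpos
        have hlow : ∀ v ∈ Q, 3 * τ / 4 ≤ ((zeroSet ℓ c v ∩ X).card : ℝ) := by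
          intro v hv
          obtain ⟨w, hw, hvw⟩ := Finset.exists_mem_ne hQ1 v
          have h1 : (zeroSet ℓ c v \ X) ⊆ zeroSet ℓ c v ∩ zeroSet ℓ c w := by
            intro x hx
            rw [Finset.mem_sdiff] at hx
            rw [Finset.mem_inter]
            refine ⟨hx.1, ?_⟩
            rw [mem_zeroSet] at hx ⊢
            exact (hXc x hx.2 v hv w hw).1 hx.1
          have h2 : ((zeroSet ℓ c v \ X).card : ℝ) ≤ s :=
            le_trans (by exact_mod_cast Finset.card_le_card h1)
              (hpair v (hQP hv) w (hQP hw) hvw.symm)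
          have h3 := Finset.card_sdiff_add_card_inter (zeroSet ℓ c v) X
          have h3' : ((zeroSet ℓ c v \ X).card : ℝ) + (zeroSet ℓ c v ∩ X).card =
              (zeroSet ℓ c v).card := by exact_mod_cast h3
          have h4 := hbig v (hQP hv)
          linarith
        have hlt : Q.card < q := by
          by_contra hc
          push Not at hc
          have h1 := union_lower' (fun v => zeroSet ℓ c v ∩ X) (3 * τ / 4) s hs0.le X Q
            (fun _ _ => Finset.inter_subset_right) hlow (by
              intro v hv w hw hvw
              refine le_trans ?_ (hpair v (hQP hv) w (hQP hw) hvw)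
              exact_mod_cast Finset.card_le_card
                (Finset.inter_subset_inter Finset.inter_subset_left Finset.inter_subset_left))
            q hc
          have h2 : (q : ℝ) * (τ / 4) ≤ X.card := le_trans (by gcongr; linarith) h1
          nlinarith [mul_le_mul_of_nonneg_right hqlow hτ0.le, mul_le_mul_of_nonneg_left h2 hs0.le,
            mul_pos hτ0 hτ0]
        have h3 : (Q.card : ℝ) ≤ q := by exact_mod_cast hlt.le
        have h4 : (0 : ℝ) ≤ q := Nat.cast_nonneg _
        nlinarith
      · have : (Q.card : ℝ) ≤ 1 := by exact_mod_cast hQ1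
        linarith
    have hsub : P ⊆ Qs.biUnion id := by
      intro v hv
      obtain ⟨Q, hQ, hvQ⟩ := hcov v hv
      exact Finset.mem_biUnion.2 ⟨Q, hQ, hvQ⟩
    have hP1 : (P.card : ℝ) ≤ Qs.card * τ := by
      have h1 : (P.card : ℝ) ≤ ((∑ Q ∈ Qs, Q.card : ℕ) : ℝ) := by
        exact_mod_cast (Finset.card_le_card hsub).trans Finset.card_biUnion_le
      refine h1.trans ?_
      push_cast
      calc ∑ Q ∈ Qs, (Q.card : ℝ) ≤ ∑ Q ∈ Qs, τ := Finset.sum_le_sum hpart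
        _ = _ := by simp
    have hK : 200 * r * Λ + 91 ≤ 291 * r * Λ := by nlinarith
    have hr0 : 0 < r := by linarith
    have hrτ : r * τ ^ 2 = 32 * s * N := by rw [hrdef]; field_simp
    calc (P.card : ℝ) * τ ^ 7 ≤ ((291 * r * Λ) ^ 4 * τ) * τ ^ 7 := by
          gcongr
          refine hP1.trans ?_
          gcongr
          refine hcard.trans ?_
          exact pow_le_pow_left₀ (by positivity) hK 4
      _ = (291 * (r * τ ^ 2) * Λ) ^ 4 := by ring
      _ = _ := by rw [hrτ]; ring

lemma final_real (p a τ B : ℝ) (hp : 0 ≤ p) (ha : 0 ≤ a) (hτ : 0 ≤ τ) (hB : 1 ≤ B)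
    (h : p * τ ^ 7 ≤ (B * a) ^ 4) :
    p * τ ≤ B * (p ^ ((6 : ℝ) / 7) * a ^ ((4 : ℝ) / 7)) := by
  have hB0 : 0 ≤ B := by linarith
  have h1 : p * τ = p ^ ((6 : ℝ) / 7) * (p * τ ^ 7) ^ ((1 : ℝ) / 7) := by
    rw [Real.mul_rpow hp (by positivity), ← Real.rpow_natCast τ 7, ← Real.rpow_mul hτ, ← mul_assoc,
      ← Real.rpow_add' hp (by norm_num)]
    norm_num
  have h2 : (p * τ ^ 7) ^ ((1 : ℝ) / 7) ≤ ((B * a) ^ 4) ^ ((1 : ℝ) / 7) :=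
    Real.rpow_le_rpow (by positivity) h (by norm_num)
  have h3 : ((B * a) ^ 4) ^ ((1 : ℝ) / 7) = B ^ ((4 : ℝ) / 7) * a ^ ((4 : ℝ) / 7) := by
    rw [← Real.mul_rpow hB0 ha, ← Real.rpow_natCast (B * a) 4, ← Real.rpow_mul (by positivity)]
    norm_num
  have h4 : B ^ ((4 : ℝ) / 7) ≤ B := by
    conv_rhs => rw [← Real.rpow_one B]
    exact Real.rpow_le_rpow_of_exponent_le hB (by norm_num)
  rw [h1]
  calc p ^ ((6 : ℝ) / 7) * (p * τ ^ 7) ^ ((1 : ℝ) / 7)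
      ≤ p ^ ((6 : ℝ) / 7) * (B ^ ((4 : ℝ) / 7) * a ^ ((4 : ℝ) / 7)) := by
        rw [← h3]; gcongr
    _ ≤ p ^ ((6 : ℝ) / 7) * (B * a ^ ((4 : ℝ) / 7)) := by gcongr
    _ = _ := by ring

lemma repCount_le (A : Finset (Fin 4 → ℤ)) (n : Fin 4 → ℤ) :
    repCount 2 (A : Set (Fin 4 → ℤ)) n ≤ (A.filter fun x => n - x ∈ A).card := by
  classical
  rw [repCount, ← Nat.card_eq_finsetCard]
  refine Nat.card_le_card_of_injective
    (fun x => (⟨x.1 0, ?_⟩ : ↥(A.filter fun x => n - x ∈ A))) ?_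
  · obtain ⟨x, hx, hn⟩ := x
    rw [Fin.sum_univ_two] at hn
    rw [Finset.mem_filter]
    refine ⟨by exact_mod_cast hx 0, ?_⟩
    have h1 : n - x 0 = x 1 := by rw [← hn, add_sub_cancel_left]
    show n - x 0 ∈ A
    rw [h1]
    exact_mod_cast hx 1
  · rintro ⟨x, hx, hn⟩ ⟨y, hy, hn'⟩ h
    have h0 : x 0 = y 0 := congrArg Subtype.val h
    rw [Fin.sum_univ_two] at hn hn'
    rw [h0] at hn
    have h1 : x 1 = y 1 := add_left_cancel (hn.trans hn'.symm)
    apply Subtype.ext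
    funext i
    fin_cases i
    · exact h0
    · exact h1

lemma sphere_pair (m : ℤ) (n x : Fin 4 → ℤ) (hx : ∑ i, x i ^ 2 = m)
    (hy : ∑ i, (n - x) i ^ 2 = m) :
    2 * ∑ i, n i * x i = ∑ i, n i ^ 2 ∧ ∑ i, n i ^ 2 ≤ 4 * m := by
  simp only [Fin.sum_univ_four, Pi.sub_apply] at *
  constructor
  · nlinarith
  · nlinarith [sq_nonneg (n 0 - 2 * x 0), sq_nonneg (n 1 - 2 * x 1), sq_nonneg (n 2 - 2 * x 2),
      sq_nonneg (n 3 - 2 * x 3)]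

lemma sphere_card (m : ℕ) (hm : 0 < m) (A : Finset (Fin 4 → ℤ))
    (hA : ∀ x ∈ A, ∑ i, x i ^ 2 = (m : ℤ)) : (A.card : ℝ) ≤ 81 * (m : ℝ) ^ 4 := by
  have hsub : A ⊆ Fintype.piFinset fun _ : Fin 4 => Finset.Icc (-(m : ℤ)) m := by
    intro x hx
    rw [Fintype.mem_piFinset]
    intro i
    have h1 : x i ^ 2 ≤ (m : ℤ) := by
      rw [← hA x hx]
      exact Finset.single_le_sum (f := fun i => x i ^ 2) (fun _ _ => sq_nonneg _) (Finset.mem_univ i)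
    rw [Finset.mem_Icc]
    have hm' : (1 : ℤ) ≤ m := by exact_mod_cast hm
    constructor <;> nlinarith
  have h1 := Finset.card_le_card hsub
  rw [Fintype.card_piFinset] at h1
  simp only [Int.card_Icc, Finset.prod_const, Finset.card_univ, Fintype.card_fin] at h1
  have h2 : ((m : ℤ) + 1 - -(m : ℤ)).toNat = 2 * m + 1 := by omega
  rw [h2] at h1
  have h3 : (A.card : ℝ) ≤ (2 * m + 1 : ℝ) ^ 4 := by exact_mod_cast h1
  refine h3.trans ?_
  have hm' : (1 : ℝ) ≤ m := by exact_mod_cast hm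
  calc (2 * m + 1 : ℝ) ^ 4 ≤ (3 * m) ^ 4 := by gcongr; linarith
    _ = _ := by ring

lemma log_bound (ε : ℝ) (hε : 0 < ε) (m : ℕ) (hm : 0 < m) (N : ℝ) (hN0 : 0 ≤ N)
    (hN : N ≤ 81 * (m : ℝ) ^ 4) :
    Real.log (10 * (N + 8) + 1) ≤ (7 + 4 / ε) * (m : ℝ) ^ ε := by
  have hm' : (1 : ℝ) ≤ m := by exact_mod_cast hm
  have hm4 : (1 : ℝ) ≤ (m : ℝ) ^ 4 := one_le_pow₀ hm'
  have hE1 : 1 ≤ (m : ℝ) ^ ε := Real.one_le_rpow hm' hε.le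
  have h1 : Real.log (10 * (N + 8) + 1) ≤ Real.log (1000 * (m : ℝ) ^ 4) :=
    Real.log_le_log (by linarith) (by linarith)
  rw [Real.log_mul (by norm_num) (by positivity), Real.log_pow] at h1
  have h2 : Real.log 1000 ≤ 7 := by
    rw [Real.log_le_iff_le_exp (by norm_num)]
    have h3 : (2.7 : ℝ) ≤ Real.exp 1 := by linarith [Real.exp_one_gt_d9]
    calc (1000 : ℝ) ≤ 2.7 ^ 7 := by norm_num
      _ ≤ Real.exp 1 ^ 7 := by gcongr
      _ = Real.exp 7 := by rw [← Real.exp_nat_mul]; norm_num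
  have h3 := Real.log_le_rpow_div (Nat.cast_nonneg m : (0 : ℝ) ≤ m) hε
  push_cast at h1
  calc _ ≤ 7 + 4 * ((m : ℝ) ^ ε / ε) := by linarith
    _ ≤ 7 * (m : ℝ) ^ ε + 4 * ((m : ℝ) ^ ε / ε) := by linarith
    _ = _ := by ring

/-- Linear functional attached to a lattice point. -/
def latL (x : Fin 4 → ℤ) : (Fin 4 → ℝ) →ₗ[ℝ] ℝ := ∑ i, (2 * (x i : ℝ)) • LinearMap.proj i

/-- Inversion of a lattice point. -/
def inv4 (n : Fin 4 → ℤ) : Fin 4 → ℝ := fun i => (n i : ℝ) / ∑ j, (n j : ℝ) ^ 2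

lemma normSq_pos (n : Fin 4 → ℤ) (hn : n ≠ 0) : (0 : ℝ) < ∑ j, (n j : ℝ) ^ 2 := by
  obtain ⟨i, hi⟩ := Function.ne_iff.1 hn
  refine Finset.sum_pos' (fun _ _ => sq_nonneg _) ⟨i, Finset.mem_univ i, ?_⟩
  have : (n i : ℝ) ≠ 0 := by exact_mod_cast hi
  positivity

lemma inv4_inj (n p : Fin 4 → ℤ) (hn : n ≠ 0) (hp : p ≠ 0) (h : inv4 n = inv4 p) : n = p := by
  have h1 := normSq_pos n hn
  have h2 := normSq_pos p hp
  have key : ∀ n : Fin 4 → ℤ, n ≠ 0 → ∑ i, inv4 n i ^ 2 = 1 / ∑ j, (n j : ℝ) ^ 2 := by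
    intro n hn
    have h1 := normSq_pos n hn
    simp only [inv4, div_pow]
    rw [← Finset.sum_div]
    field_simp
  have h3 : ∑ j, (n j : ℝ) ^ 2 = ∑ j, (p j : ℝ) ^ 2 := by
    have h4 := key n hn
    rw [h, key p hp] at h4
    field_simp at h4
    linarith
  funext i
  have h4 := congrFun h i
  simp only [inv4] at h4
  rw [h3, div_left_inj' h2.ne'] at h4
  exact_mod_cast h4

lemma latL_zero (x n : Fin 4 → ℤ) (hn : n ≠ 0) :
    latL x (inv4 n) + (-1) = 0 ↔ 2 * ∑ i, n i * x i = ∑ i, n i ^ 2 := by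
  have h1 := normSq_pos n hn
  have h2 : latL x (inv4 n) = (2 * ∑ i, (n i : ℝ) * x i) / ∑ j, (n j : ℝ) ^ 2 := by
    simp only [latL, LinearMap.sum_apply, LinearMap.smul_apply, LinearMap.proj_apply, smul_eq_mul,
      inv4]
    rw [Finset.mul_sum, Finset.sum_div]
    refine Finset.sum_congr rfl fun i _ => ?_
    ring
  rw [h2, add_neg_eq_zero, div_eq_one_iff_eq h1.ne']
  constructor
  · intro h; exact_mod_cast h
  · intro h; exact_mod_cast h

theorem statement_16 (ε : ℝ) (hε : 0 < ε) :
    ∃ C : ℝ, 0 < C ∧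
      ∀ m : ℕ, 0 < m → ∀ A : Set (Fin 4 → ℤ), A.Finite → A.Nonempty → A ⊆ latSphere 4 m →
        ∀ τ : ℝ, 1 ≤ τ →
          ∀ Pτ : Set (Fin 4 → ℤ),
            Pτ = {n | τ ≤ (repCount 2 A n : ℝ) ∧ (repCount 2 A n : ℝ) < 2 * τ} →
            (Pτ.ncard : ℝ) * τ ≤ C * (m : ℝ) ^ ε *
              ((Pτ.ncard : ℝ) ^ ((6 : ℝ) / 7) * (A.ncard : ℝ) ^ ((4 : ℝ) / 7) +
                (Pτ.ncard : ℝ) + (A.ncard : ℝ)) := by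
  classical
  obtain ⟨C1, hC1, hcirc⟩ := circle_bound (ε / 2) (by linarith)
  set C2 : ℝ := 7 + 4 / (ε / 2) with hC2
  have hC2' : 7 ≤ C2 := by
    have : 0 < 4 / (ε / 2) := by positivity
    linarith
  have hC12 : 1 ≤ C1 * C2 := by nlinarith
  refine ⟨10000 * (C1 * C2) + 1, by linarith, ?_⟩
  intro m hm A0 hAfin hAne hAsph τ hτ P0 hP0
  have hm' : (1 : ℝ) ≤ m := by exact_mod_cast hm
  have hE1 : 1 ≤ (m : ℝ) ^ ε := Real.one_le_rpow hm' hε.le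
  have hh1 : 1 ≤ (m : ℝ) ^ (ε / 2) := Real.one_le_rpow hm' (by linarith)
  have hhh : (m : ℝ) ^ (ε / 2) * (m : ℝ) ^ (ε / 2) = (m : ℝ) ^ ε := by
    rw [← Real.rpow_add (by linarith)]; congr 1; ring
  rcases P0.finite_or_infinite with hPfin | hPinf
  swap
  · rw [hPinf.ncard]
    simp only [Nat.cast_zero, zero_mul]
    positivity
  obtain ⟨A, rfl⟩ := hAfin.exists_finset_coe
  obtain ⟨P, rfl⟩ := hPfin.exists_finset_coe
  rw [Set.ncard_coe_finset, Set.ncard_coe_finset]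
  have hA : ∀ x ∈ A, ∑ i, x i ^ 2 = (m : ℤ) := fun x hx => hAsph hx
  have hPr : ∀ n ∈ P, τ ≤ ((A.filter fun x => n - x ∈ A).card : ℝ) := by
    intro n hn
    have h1 : n ∈ (P : Set (Fin 4 → ℤ)) := hn
    rw [hP0] at h1
    exact h1.1.trans (by exact_mod_cast repCount_le A n)
  have hPs : ∀ n ∈ P, ∑ i, n i ^ 2 ≤ 4 * (m : ℤ) := by
    intro n hn
    have h1 := hPr n hn
    have h2 : 0 < (A.filter fun x => n - x ∈ A).card := by
      have : (0 : ℝ) < ((A.filter fun x => n - x ∈ A).card : ℝ) := by linarith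
      exact_mod_cast this
    obtain ⟨x, hx⟩ := Finset.card_pos.1 h2
    rw [Finset.mem_filter] at hx
    exact (sphere_pair m n x (hA x hx.1) (hA _ hx.2)).2
  set a : ℝ := (A.card : ℝ) with ha
  set p : ℝ := (P.card : ℝ) with hp
  set E : ℝ := (m : ℝ) ^ ε with hE
  set h : ℝ := (m : ℝ) ^ (ε / 2) with hh
  have ha0 : 0 ≤ a := Nat.cast_nonneg _
  have hp0 : 0 ≤ p := Nat.cast_nonneg _
  set s := C1 * h with hs
  have hs1 : 1 ≤ s := by nlinarith
  have hR0 : 0 ≤ p ^ ((6 : ℝ) / 7) * a ^ ((4 : ℝ) / 7) := by positivity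
  set R := p ^ ((6 : ℝ) / 7) * a ^ ((4 : ℝ) / 7) with hR
  have hhE : h ≤ E := by nlinarith
  have hC1E : s ≤ C1 * C2 * E := by
    calc s ≤ C1 * 1 * E := by rw [hs, mul_one]; gcongr
      _ ≤ C1 * C2 * E := by gcongr; linarith
  have hCE : 1 ≤ C1 * C2 * E := by linarith
  have hexp : (10000 * (C1 * C2) + 1) * E * (R + p + a) =
      (10000 * (C1 * C2 * E) + E) * R + (10000 * (C1 * C2 * E) + E) * p
        + 10000 * (C1 * C2 * E) * a + E * a := by ring
  rw [hexp]
  have hEa : a ≤ E * a := by nlinarith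
  have hDR : 0 ≤ (10000 * (C1 * C2 * E) + E) * R := by positivity
  have hDp : 0 ≤ (10000 * (C1 * C2 * E) + E) * p := by positivity
  have hDa : 2 * a ≤ 10000 * (C1 * C2 * E) * a := by gcongr; linarith
  rcases lt_or_ge τ (4 * s) with hτs | hτs
  · have : p * τ ≤ (10000 * (C1 * C2 * E) + E) * p := by
      rw [mul_comm]; gcongr; linarith
    linarith
  set P' := P.filter fun n => n ≠ 0 with hP'
  set p' : ℝ := (P'.card : ℝ) with hp'
  have hp'0 : 0 ≤ p' := Nat.cast_nonneg _
  have hp'p : p' ≤ p := by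
    rw [hp', hp]; exact_mod_cast Finset.card_le_card (Finset.filter_subset _ _)
  have hremove : p * τ ≤ p' * τ + a := by
    by_cases h0 : (0 : Fin 4 → ℤ) ∈ P
    · have h1 : τ ≤ a := (hPr 0 h0).trans (by
        rw [ha]; exact_mod_cast Finset.card_le_card (Finset.filter_subset _ _))
      have h2 : P' = P.erase 0 := by
        ext n; simp [hP', and_comm]
      have h3 : p = p' + 1 := by
        rw [hp, hp', h2, ← Finset.card_erase_add_one h0]; push_cast; ring
      rw [h3]; linarith
    · have h2 : P' = P := by
        rw [hP', Finset.filter_eq_self]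
        intro n hn h; exact h0 (h ▸ hn)
      have : p = p' := by rw [hp, hp', h2]
      rw [this]; linarith
  have hcardP' : (P'.image inv4).card = P'.card := by
    refine Finset.card_image_of_injOn ?_
    intro n hn q hq h
    exact inv4_inj n q (Finset.mem_filter.1 hn).2 (Finset.mem_filter.1 hq).2 h
  have hzs : ∀ n : Fin 4 → ℤ, n ≠ 0 → ∀ x : A,
      (x ∈ zeroSet (fun x : A => latL x.1) (fun _ => -1) (inv4 n) ↔
        2 * ∑ i, n i * x.1 i = ∑ i, n i ^ 2) := by
    intro n hn x
    rw [mem_zeroSet, aff, latL_zero _ _ hn]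
  have hinc := incidence (fun x : A => latL x.1) (fun _ => -1) (P'.image inv4) s τ hs1 hτs
    (by
      intro v hv
      obtain ⟨n, hn, rfl⟩ := Finset.mem_image.1 hv
      obtain ⟨hnP, hn0⟩ := Finset.mem_filter.1 hn
      refine (hPr n hnP).trans ?_
      have hsub : (A.filter fun x => n - x ∈ A) ⊆
          (zeroSet (fun x : A => latL x.1) (fun _ => -1) (inv4 n)).map
            (Function.Embedding.subtype _) := by
        intro x hx
        rw [Finset.mem_filter] at hx
        rw [Finset.mem_map]
        refine ⟨⟨x, hx.1⟩, ?_, rfl⟩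
        rw [hzs n hn0]
        exact (sphere_pair m n x (hA x hx.1) (hA _ hx.2)).1
      have := Finset.card_le_card hsub
      rw [Finset.card_map] at this
      exact_mod_cast this)
    (by
      intro v hv w hw hvw
      obtain ⟨n, hn, rfl⟩ := Finset.mem_image.1 hv
      obtain ⟨q, hq, rfl⟩ := Finset.mem_image.1 hw
      obtain ⟨hnP, hn0⟩ := Finset.mem_filter.1 hn
      obtain ⟨hqP, hq0⟩ := Finset.mem_filter.1 hq
      have hc := hcirc m hm n q (fun h => hvw (by rw [h])) hn0 hq0 (hPs n hnP) (hPs q hqP)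
        ((zeroSet (fun x : A => latL x.1) (fun _ => -1) (inv4 n) ∩
          zeroSet (fun x : A => latL x.1) (fun _ => -1) (inv4 q)).map
            (Function.Embedding.subtype _)) (by
          intro x hx
          obtain ⟨y, hy, rfl⟩ := Finset.mem_map.1 hx
          rw [Finset.mem_inter, hzs n hn0, hzs q hq0] at hy
          exact ⟨hA _ y.2, hy.1, hy.2⟩)
      rw [Finset.card_map] at hc
      exact hc)
  rw [hcardP', Fintype.card_coe, ← hp', ← ha] at hinc
  rcases hinc with hinc | hinc
  · linarith
  · have hΛ := log_bound (ε / 2) (by linarith) m hm a ha0 (sphere_card m hm A hA)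
    rw [← hC2, ← hh] at hΛ
    have hΛ0 : 0 ≤ Real.log (10 * (a + 8) + 1) := Real.log_nonneg (by linarith)
    have hB : 9312 * s * Real.log (10 * (a + 8) + 1) * a ≤ (10000 * (C1 * C2 * E)) * a := by
      refine mul_le_mul_of_nonneg_right ?_ ha0
      calc 9312 * s * Real.log (10 * (a + 8) + 1) ≤ 9312 * s * (C2 * h) := by gcongr
        _ = 9312 * (C1 * C2 * E) := by rw [hs, ← hhh]; ring
        _ ≤ _ := by linarith
    have h1 := final_real p' a τ (10000 * (C1 * C2 * E)) hp'0 ha0 (by linarith) (by linarith)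
      (hinc.trans (pow_le_pow_left₀ (by positivity) hB 4))
    have h2 : p' ^ ((6 : ℝ) / 7) * a ^ ((4 : ℝ) / 7) ≤ R := by rw [hR]; gcongr
    have h3 : p' * τ ≤ 10000 * (C1 * C2 * E) * R :=
      h1.trans (mul_le_mul_of_nonneg_left h2 (by linarith))
    have h4 : 0 ≤ E * R := by positivity
    linarith
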